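/- arXiv:1801.09976 — 2 statements merged into one kernel-verified Lean document; each statement's English description precedes it below -/
import Mathlib

section
/- Let B_0(b_11) be the symmetric 5×5 matrix whose (1,1) entry is the variable b_11, whose (i,j) entries for |i−j| ≤ 1 and (i,j) ≠ (1,1) are all equal to 1, and whose remaining entries are 0. Then the resolvent Φ(z; Id_5, B_0(b_11)), regarded as a polynomial in the two variables z and b_11, is irreducible of degree 10 over the algebraic closure ℚ̄ of ℚ. -/
open MvPolynomial

/-- An algebraic closure of `ℚ`. -/
noncomputable abbrev Qbar : Type := AlgebraicClosure ℚ

/-- The symmetric `5×5` matrix `B₀(b₁₁)` with `(1,1)` entry `b₁₁`, entries `1` at all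
positions `(i,j) ≠ (1,1)` with `|i - j| ≤ 1`, and `0` elsewhere (0-based indices). -/
noncomputable def B0 (b : Qbar) : Matrix (Fin 5) (Fin 5) Qbar :=
  Matrix.of fun i j =>
    if i = 0 ∧ j = 0 then b
    else if (i : ℕ) ≤ (j : ℕ) + 1 ∧ (j : ℕ) ≤ (i : ℕ) + 1 then 1 else 0

/-- The polynomial `∏_{i<j} (v + yᵢ + yⱼ)`, where
`∏ᵢ (x + yᵢ) = x⁵ + t x⁴ - 4 x³ - 3 t x² + 3 x + t`. -/
def pairSumResolvent {R : Type*} [CommRing R] (v t : R) : R :=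
  v ^ 10 + 4 * v ^ 9 * t + 6 * v ^ 8 * t ^ 2 - 12 * v ^ 8 + 4 * v ^ 7 * t ^ 3 - 39 * v ^ 7 * t
    + v ^ 6 * t ^ 4 - 48 * v ^ 6 * t ^ 2 + 39 * v ^ 6 - 27 * v ^ 5 * t ^ 3 + 94 * v ^ 5 * t
    - 6 * v ^ 4 * t ^ 4 + 83 * v ^ 4 * t ^ 2 - 40 * v ^ 4 + 32 * v ^ 3 * t ^ 3 - 60 * v ^ 3 * t
    + 5 * v ^ 2 * t ^ 4 - 30 * v ^ 2 * t ^ 2 + 12 * v ^ 2 - 5 * v * t ^ 3 + 8 * v * t + t ^ 2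

lemma map_pairSumResolvent {R S F : Type*} [CommRing R] [CommRing S] [FunLike F R S]
    [RingHomClass F R S] (f : F) (v t : R) :
    f (pairSumResolvent v t) = pairSumResolvent (f v) (f t) := by
  simp [pairSumResolvent, map_ofNat f]

/-- The pair sum resolvent of four elements in terms of their elementary symmetric functions. -/
lemma prod_pair_sums_four {R : Type*} [CommRing R] {v y₁ y₂ y₃ y₄ a₁ a₂ a₃ a₄ : R}
    (h₁ : y₁ + y₂ + y₃ + y₄ = a₁)
    (h₂ : y₁ * y₂ + y₁ * y₃ + y₁ * y₄ + y₂ * y₃ + y₂ * y₄ + y₃ * y₄ = a₂)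
    (h₃ : y₁ * y₂ * y₃ + y₁ * y₂ * y₄ + y₁ * y₃ * y₄ + y₂ * y₃ * y₄ = a₃)
    (h₄ : y₁ * y₂ * y₃ * y₄ = a₄) :
    (v + y₁ + y₂) * (v + y₁ + y₃) * (v + y₁ + y₄) * (v + y₂ + y₃) * (v + y₂ + y₄) * (v + y₃ + y₄) =
      (v ^ 2 + a₁ * v) ^ 3 + 2 * a₂ * (v ^ 2 + a₁ * v) ^ 2
        + (a₂ ^ 2 + a₁ * a₃ - 4 * a₄) * (v ^ 2 + a₁ * v)
        + (a₁ * a₂ * a₃ - a₁ ^ 2 * a₄ - a₃ ^ 2) := by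
  subst h₁ h₂ h₃ h₄
  ring

lemma prod_add_four {R : Type*} [CommRing R] {x y₁ y₂ y₃ y₄ a₁ a₂ a₃ a₄ : R}
    (h₁ : y₁ + y₂ + y₃ + y₄ = a₁)
    (h₂ : y₁ * y₂ + y₁ * y₃ + y₁ * y₄ + y₂ * y₃ + y₂ * y₄ + y₃ * y₄ = a₂)
    (h₃ : y₁ * y₂ * y₃ + y₁ * y₂ * y₄ + y₁ * y₃ * y₄ + y₂ * y₃ * y₄ = a₃)
    (h₄ : y₁ * y₂ * y₃ * y₄ = a₄) :
    (x + y₁) * (x + y₂) * (x + y₃) * (x + y₄) = x ^ 4 + a₁ * x ^ 3 + a₂ * x ^ 2 + a₃ * x + a₄ := by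
  subst h₁ h₂ h₃ h₄
  ring

lemma prod_pair_sums_eq_pairSumResolvent {K : Type*} [Field K] [CharZero K] {y : Fin 5 → K} {t : K}
    (hy : ∀ x : K, ∏ i, (x + y i) = x ^ 5 + t * x ^ 4 - 4 * x ^ 3 - 3 * t * x ^ 2 + 3 * x + t)
    (v : K) : ∏ i : Fin 5, ∏ j ∈ Finset.Ioi i, (v + y i + y j) = pairSumResolvent v t := by
  have I0 : Finset.Ioi (0 : Fin 5) = {1, 2, 3, 4} := by decide
  have I1 : Finset.Ioi (1 : Fin 5) = {2, 3, 4} := by decide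
  have I2 : Finset.Ioi (2 : Fin 5) = {3, 4} := by decide
  have I3 : Finset.Ioi (3 : Fin 5) = {4} := by decide
  have I4 : Finset.Ioi (4 : Fin 5) = ∅ := by decide
  simp only [Fin.prod_univ_five] at hy
  rw [Fin.prod_univ_five, I0, I1, I2, I3, I4]
  simp only [Finset.prod_insert, Finset.mem_insert, Finset.mem_singleton, Fin.reduceEq, or_self,
    not_false_eq_true, Finset.prod_singleton, Finset.prod_empty, mul_one]
  generalize y 0 = y₁ at *
  generalize y 1 = y₂ at *
  generalize y 2 = y₃ at *
  generalize y 3 = y₄ at *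
  generalize y 4 = y₅ at *
  have p0 := hy 0
  have p1 := hy 1
  have m1 := hy (-1)
  have p2 := hy 2
  have m2 := hy (-2)
  have h₁ : y₁ + y₂ + y₃ + y₄ = t - y₅ := by
    linear_combination (p2 + m2 - 4 * p1 - 4 * m1 + 6 * p0) / 24
  have h₂ : y₁ * y₂ + y₁ * y₃ + y₁ * y₄ + y₂ * y₃ + y₂ * y₄ + y₃ * y₄ =
      -4 - y₅ * (t - y₅) := by
    linear_combination (p2 - m2 - 2 * p1 + 2 * m1) / 12 - y₅ * h₁
  have h₃ : y₁ * y₂ * y₃ + y₁ * y₂ * y₄ + y₁ * y₃ * y₄ + y₂ * y₃ * y₄ =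
      -3 * t - y₅ * (-4 - y₅ * (t - y₅)) := by
    linear_combination (-p2 - m2 + 16 * p1 + 16 * m1 - 30 * p0) / 24 - y₅ * h₂
  have h₄ : y₁ * y₂ * y₃ * y₄ = 3 - y₅ * (-3 * t - y₅ * (-4 - y₅ * (t - y₅))) := by
    linear_combination (-p2 + m2 + 8 * p1 - 8 * m1) / 12 - y₅ * h₃
  have h₅ : t - y₅ * (3 - y₅ * (-3 * t - y₅ * (-4 - y₅ * (t - y₅)))) = 0 := by
    linear_combination -p0 + y₅ * h₄
  have h6 := prod_pair_sums_four (v := v) h₁ h₂ h₃ h₄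
  have h4 := prod_add_four (x := v + y₅) h₁ h₂ h₃ h₄
  have hc : ∀ a b c d e f g h i j : K, a * (b * (c * d)) * (e * (f * g)) * (h * i) * j =
      d * g * i * j * (a * b * c * e * f * h) := fun a b c d e f g h i j ↦ by ring
  calc _ = ((v + y₅ + y₁) * (v + y₅ + y₂) * (v + y₅ + y₃) * (v + y₅ + y₄)) *
        ((v + y₁ + y₂) * (v + y₁ + y₃) * (v + y₁ + y₄) * (v + y₂ + y₃) * (v + y₂ + y₄) *
          (v + y₃ + y₄)) := by
            rw [hc, add_right_comm v y₅ y₁, add_right_comm v y₅ y₂, add_right_comm v y₅ y₃,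
              add_right_comm v y₅ y₄]
    _ = pairSumResolvent v t := by
      rw [h6, h4, pairSumResolvent]
      linear_combination (11 * v ^ 5 + 22 * v ^ 4 * t + 16 * v ^ 3 * t ^ 2 - 16 * v ^ 3
        + 4 * v ^ 2 * t ^ 3 - 15 * v ^ 2 * t - 4 * v * t ^ 2 + 4 * v - t * y₅ ^ 4 + 3 * t * y₅ ^ 2
        - t + y₅ ^ 5 - 4 * y₅ ^ 3 + 3 * y₅) * h₅

lemma det_B0 (b : Qbar) :
    Matrix.det (Matrix.of fun i j =>
        (if i = j then Polynomial.X else 0) + Polynomial.C (B0 b i j)) =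
      (Polynomial.X + 1) ^ 5 + Polynomial.C (b - 1) * (Polynomial.X + 1) ^ 4
        - 4 * (Polynomial.X + 1) ^ 3 - 3 * Polynomial.C (b - 1) * (Polynomial.X + 1) ^ 2
        + 3 * (Polynomial.X + 1) + Polynomial.C (b - 1) := by
  have hB : (Matrix.of fun i j : Fin 5 =>
        (if i = j then (Polynomial.X : Polynomial Qbar) else 0) + Polynomial.C (B0 b i j)) =
      !![Polynomial.X + Polynomial.C b, 1, 0, 0, 0;
        1, Polynomial.X + 1, 1, 0, 0;
        0, 1, Polynomial.X + 1, 1, 0;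
        0, 0, 1, Polynomial.X + 1, 1;
        0, 0, 0, 1, Polynomial.X + 1] := by
    ext i j : 2
    fin_cases i <;> fin_cases j <;> simp [B0]
  rw [hB]
  simp [Matrix.det_succ_row_zero, Fin.sum_univ_succ, Fin.succAbove]
  ring

lemma Polynomial.Splits.exists_eq_prod_X_add_C {K : Type*} [Field K] {p : Polynomial K} {n : ℕ}
    (hs : p.Splits) (hm : p.Monic) (hn : p.natDegree = n) :
    ∃ α : Fin n → K, p = ∏ i, (Polynomial.X + Polynomial.C (α i)) := by
  obtain ⟨l, hl⟩ := Quot.exists_rep p.roots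
  have hp := hs.eq_prod_roots_of_monic hm
  have hc := hs.natDegree_eq_card_roots
  rw [← hl] at hp hc
  obtain rfl : l.length = n := by rw [← hn, hc]; rfl
  refine ⟨fun i ↦ -l.get i, hp.trans ?_⟩
  simp only [Polynomial.C_neg, ← sub_eq_add_neg]
  rw [← List.prod_ofFn]
  change (l.map _).prod = _
  congr 1
  conv_lhs => rw [← List.ofFn_get l, List.map_ofFn]
  rfl

/-- For every value of `b₁₁` there is a root enumeration. -/
lemma exists_det_B0_eq_prod (b : Qbar) : ∃ α : Fin 5 → Qbar,
    Matrix.det (Matrix.of fun i j =>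
        (if i = j then Polynomial.X else 0) + Polynomial.C (B0 b i j)) =
      ∏ i : Fin 5, (Polynomial.X + Polynomial.C (α i)) := by
  rw [det_B0]
  refine (IsAlgClosed.splits _).exists_eq_prod_X_add_C ?_ ?_
  · monicity!
  · compute_degree!

lemma eq_map_pairSumResolvent (Φ : MvPolynomial (Fin 2) Qbar)
    (hΦ : ∀ b z : Qbar, ∀ α : Fin 5 → Qbar,
      Matrix.det (Matrix.of fun i j =>
          (if i = j then Polynomial.X else 0) + Polynomial.C (B0 b i j)) =
        ∏ i : Fin 5, (Polynomial.X + Polynomial.C (α i)) →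
      MvPolynomial.eval ![z, b] Φ =
        ∏ i : Fin 5, ∏ j ∈ Finset.Ioi i, (z + α i + α j)) :
    Φ = pairSumResolvent (X 0 + 2) (X 1 - 1) := by
  refine MvPolynomial.funext fun x ↦ ?_
  obtain ⟨α, hα⟩ := exists_det_B0_eq_prod (x 1)
  have hx : x = ![x 0, x 1] := by ext i; fin_cases i <;> rfl
  rw [map_pairSumResolvent]
  conv_lhs => rw [hx, hΦ _ _ α hα]
  simp only [map_add, map_sub, eval_X, map_one, map_ofNat]
  rw [← prod_pair_sums_eq_pairSumResolvent (y := fun i ↦ α i - 1)]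
  · refine Finset.prod_congr rfl fun i _ ↦ Finset.prod_congr rfl fun j _ ↦ ?_
    ring
  · intro w
    rw [det_B0] at hα
    have := congr_arg (Polynomial.eval (w - 1)) hα
    simp [Polynomial.eval_prod] at this
    rw [this]
    exact Finset.prod_congr rfl fun i _ ↦ by ring

namespace Polynomial

/-- A quintic over `𝔽₂` without roots which is coprime to `X² + X + 1` is irreducible. -/
lemma irreducible_quintic_zmod_two {q u k : (ZMod 2)[X]} (hm : q.Monic) (hd : q.natDegree = 5)
    (h0 : q.eval 0 ≠ 0) (h1 : q.eval 1 ≠ 0) (hk : q * u = (X ^ 2 + X + 1) * k + 1) :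
    Irreducible q := by
  have hq1 : q ≠ 1 := by
    rintro rfl
    simp at hd
  rw [hm.irreducible_iff_lt_natDegree_lt hq1, hd]
  intro g hg hgd hgq
  have hroot (a : ZMod 2) : g.eval a ≠ 0 := by
    intro ha
    have := eval_dvd (x := a) hgq
    rw [ha, zero_dvd_iff] at this
    fin_cases a
    · exact h0 this
    · exact h1 this
  have hgd' : g.natDegree = 1 ∨ g.natDegree = 2 := by
    simp only [Finset.mem_Ioc] at hgd
    omega
  obtain hgd | hgd := hgd'
  · rw [hg.eq_X_add_C hgd] at hroot
    exact hroot (-g.coeff 0) (by simp [CharTwo.add_self_eq_zero])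
  · have hg2 : g.coeff 2 = 1 := by simpa [hgd] using hg.coeff_natDegree
    have hge := eq_quadratic_of_degree_le_two (natDegree_le_iff_degree_le.mp hgd.le)
    have hr0 := hroot 0
    have hr1 := hroot 1
    rw [hge, hg2] at hr0 hr1
    simp only [eval_add, eval_mul, eval_pow, eval_C, eval_X] at hr0 hr1
    have hcoeff : ∀ b c : ZMod 2, 1 * 0 ^ 2 + b * 0 + c ≠ 0 → 1 * 1 ^ 2 + b * 1 + c ≠ 0 →
        b = 1 ∧ c = 1 := by decide
    obtain ⟨hb, hc⟩ := hcoeff _ _ hr0 hr1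
    rw [hg2, hb, hc, C_1, one_mul, one_mul] at hge
    rw [← hge] at hk
    have hu : g ∣ 1 := (dvd_add_right (dvd_mul_right g k)).mp (hk ▸ hgq.mul_right u)
    have := natDegree_eq_zero_of_isUnit (isUnit_of_dvd_one hu)
    omega

lemma irreducible_cubic_zmod_seven {a b c : ZMod 7}
    (h : ∀ x : ZMod 7, x ^ 3 + a * x ^ 2 + b * x + c ≠ 0) :
    Irreducible (X ^ 3 + C a * X ^ 2 + C b * X + C c : (ZMod 7)[X]) := by
  have : Fact (Nat.Prime 7) := ⟨by norm_num⟩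
  refine irreducible_of_degree_le_three_of_not_isRoot ?_ fun x hx ↦ h x (by simpa using hx)
  have : (X ^ 3 + C a * X ^ 2 + C b * X + C c : (ZMod 7)[X]).natDegree = 3 := by compute_degree!
  simp [this]

lemma natDegree_cubic_zmod_seven (a b c : ZMod 7) :
    (X ^ 3 + C a * X ^ 2 + C b * X + C c : (ZMod 7)[X]).natDegree = 3 := by
  have : Fact (Nat.Prime 7) := ⟨by norm_num⟩
  compute_degree!

lemma monic_pairSumResolvent_three : (pairSumResolvent X 3 : ℤ[X]).Monic := by
  unfold pairSumResolvent
  monicity!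

lemma natDegree_pairSumResolvent_three : (pairSumResolvent X 3 : ℤ[X]).natDegree = 10 := by
  unfold pairSumResolvent
  compute_degree!

lemma pairSumResolvent_zmod_two : (pairSumResolvent X 3 : (ZMod 2)[X]) =
    (X ^ 5 + X ^ 3 + 1) * (X ^ 5 + X ^ 3 + X ^ 2 + X + 1) := by
  have h2 : (2 : (ZMod 2)[X]) = 0 := CharTwo.two_eq_zero
  unfold pairSumResolvent
  linear_combination (6 * X ^ 9 + 20 * X ^ 8 - 5 * X ^ 7 - 157 * X ^ 6 - 225 * X ^ 5
    + 110 * X ^ 4 + 341 * X ^ 3 + 73 * X ^ 2 - 56 * X + 4) * h2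

lemma pairSumResolvent_zmod_seven : (pairSumResolvent X 3 : (ZMod 7)[X]) =
    (X + 1) * ((X ^ 3 + C 3 * X ^ 2 + C 4 * X + C 3) * (X ^ 3 + C 4 * X ^ 2 + C 4 * X + C 4) *
      (X ^ 3 + C 4 * X ^ 2 + C 4 * X + C 6)) := by
  have h7 : (7 : (ZMod 7)[X]) = 0 := by
    exact_mod_cast CharP.cast_eq_zero (ZMod 7)[X] 7
  unfold pairSumResolvent
  simp only [map_ofNat]
  linear_combination (-3 * X ^ 8 - 30 * X ^ 7 - 109 * X ^ 6 - 171 * X ^ 5 - 103 * X ^ 4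
    - 30 * X ^ 3 - 67 * X ^ 2 - 57 * X - 9) * h7

/-- A nonconstant proper monic factor over `𝔽₂` has degree `5`. -/
lemma natDegree_eq_five_of_mul_eq {g h : (ZMod 2)[X]} (hgh : g * h = pairSumResolvent X 3)
    (hg : 0 < g.natDegree) (hh : 0 < h.natDegree) : h.natDegree = 5 := by
  have h2 : (2 : (ZMod 2)[X]) = 0 := CharTwo.two_eq_zero
  have hd₁ : (X ^ 5 + X ^ 3 + 1 : (ZMod 2)[X]).natDegree = 5 := by compute_degree!
  have hd₂ : (X ^ 5 + X ^ 3 + X ^ 2 + X + 1 : (ZMod 2)[X]).natDegree = 5 := by compute_degree!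
  have hq₁ : Irreducible (X ^ 5 + X ^ 3 + 1 : (ZMod 2)[X]) := by
    refine irreducible_quintic_zmod_two (u := X) (k := X ^ 4 + X ^ 3 + X ^ 2 + 1)
      (by monicity!) hd₁ (by simp) (by simp; decide) ?_
    linear_combination (-(X ^ 5 + X ^ 4 + X ^ 3 + X ^ 2 + 1)) * h2
  have hq₂ : Irreducible (X ^ 5 + X ^ 3 + X ^ 2 + X + 1 : (ZMod 2)[X]) := by
    refine irreducible_quintic_zmod_two (u := X ^ 2)
      (k := X ^ 5 + X ^ 4 + X ^ 3 + X ^ 2 + X + 1)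
      (by monicity!) hd₂ (by simp) (by simp; decide) ?_
    linear_combination (-(X ^ 6 + X ^ 5 + X ^ 4 + X ^ 3 + X ^ 2 + X + 1)) * h2
  rw [pairSumResolvent_zmod_two] at hgh
  generalize (X ^ 5 + X ^ 3 + 1 : (ZMod 2)[X]) = q₁ at *
  generalize (X ^ 5 + X ^ 3 + X ^ 2 + X + 1 : (ZMod 2)[X]) = q₂ at *
  have key {a b : (ZMod 2)[X]} (hab : a * b = q₁ * q₂) (hb : 0 < b.natDegree) (ha : q₁ ∣ a) :
      b.natDegree = 5 := by
    obtain ⟨c, rfl⟩ := ha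
    rw [mul_assoc] at hab
    have hcb := mul_left_cancel₀ hq₁.ne_zero hab
    obtain hc | hb' := hq₂.isUnit_or_isUnit hcb.symm
    · rw [← hd₂, ← hcb, natDegree_mul hc.ne_zero (by rintro rfl; simp at hb),
        natDegree_eq_zero_of_isUnit hc, zero_add]
    · rw [natDegree_eq_zero_of_isUnit hb'] at hb
      exact absurd hb (lt_irrefl 0)
  obtain h₁ | h₁ := hq₁.prime.dvd_or_dvd (Dvd.intro _ hgh.symm)
  · exact key hgh hh h₁
  · have := key ((mul_comm h g).trans hgh) hg h₁
    have hsum := congr_arg natDegree hgh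
    rw [natDegree_mul (by rintro rfl; simp at hg) (by rintro rfl; simp at hh),
      natDegree_mul hq₁.ne_zero hq₂.ne_zero] at hsum
    omega

lemma false_of_dvd_of_natDegree_eq_five {K : Type*} [Field K] {p a b : K[X]}
    (hp : p.natDegree = 5) (ha : Irreducible a) (hb : Irreducible b) (had : a.natDegree = 3)
    (hbd : b.natDegree = 3) (hma : a.Monic) (hmb : b.Monic) (hab : a ≠ b) (hap : a ∣ p)
    (hbp : b ∣ p) : False := by
  have hcop : IsCoprime a b := ha.coprime_iff_not_dvd.mpr fun hdvd ↦
    hab (eq_of_monic_of_associated hma hmb (ha.associated_of_dvd hb hdvd))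
  have := natDegree_le_of_dvd (hcop.mul_dvd hap hbp) (by rintro rfl; simp at hp)
  rw [natDegree_mul ha.ne_zero hb.ne_zero] at this
  omega

/-- A product of two quintics has at most two distinct monic irreducible cubic factors. -/
lemma false_of_three_cubics_dvd {K : Type*} [Field K] {g h a b c : K[X]}
    (hg : g.natDegree = 5) (hh : h.natDegree = 5)
    (ha : Irreducible a) (hb : Irreducible b) (hc : Irreducible c) (had : a.natDegree = 3)
    (hbd : b.natDegree = 3) (hcd : c.natDegree = 3) (hma : a.Monic) (hmb : b.Monic) (hmc : c.Monic)
    (hab : a ≠ b) (hac : a ≠ c) (hbc : b ≠ c) (hgh : a * b * c ∣ g * h) : False := by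
  have tab {p : K[X]} (hp : p.natDegree = 5) :=
    false_of_dvd_of_natDegree_eq_five hp ha hb had hbd hma hmb hab
  have tac {p : K[X]} (hp : p.natDegree = 5) :=
    false_of_dvd_of_natDegree_eq_five hp ha hc had hcd hma hmc hac
  have tbc {p : K[X]} (hp : p.natDegree = 5) :=
    false_of_dvd_of_natDegree_eq_five hp hb hc hbd hcd hmb hmc hbc
  rcases ha.prime.dvd_or_dvd (((dvd_mul_right a b).mul_right c).trans hgh) with h₁ | h₁ <;>
  rcases hb.prime.dvd_or_dvd (((dvd_mul_left b a).mul_right c).trans hgh) with h₂ | h₂ <;>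
  rcases hc.prime.dvd_or_dvd ((dvd_mul_left c (a * b)).trans hgh) with h₃ | h₃
  · exact tab hg h₁ h₂
  · exact tab hg h₁ h₂
  · exact tac hg h₁ h₃
  · exact tbc hh h₂ h₃
  · exact tbc hg h₂ h₃
  · exact tac hh h₁ h₃
  · exact tab hh h₁ h₂
  · exact tab hh h₁ h₂

/-- There is no factorization into two factors of degree `5` over `𝔽₇`. -/
lemma not_natDegree_eq_five {g h : (ZMod 7)[X]} (hgh : g * h = pairSumResolvent X 3)
    (hg : g.natDegree = 5) (hh : h.natDegree = 5) : False := by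
  have irr₁ : Irreducible (X ^ 3 + C 3 * X ^ 2 + C 4 * X + C 3 : (ZMod 7)[X]) :=
    irreducible_cubic_zmod_seven (by decide)
  have irr₂ : Irreducible (X ^ 3 + C 4 * X ^ 2 + C 4 * X + C 4 : (ZMod 7)[X]) :=
    irreducible_cubic_zmod_seven (by decide)
  have irr₃ : Irreducible (X ^ 3 + C 4 * X ^ 2 + C 4 * X + C 6 : (ZMod 7)[X]) :=
    irreducible_cubic_zmod_seven (by decide)
  have hne {a b c a' b' c' : ZMod 7} (hc : c ≠ c') :
      (X ^ 3 + C a * X ^ 2 + C b * X + C c : (ZMod 7)[X]) ≠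
        X ^ 3 + C a' * X ^ 2 + C b' * X + C c' :=
    fun h ↦ hc (by simpa using congr_arg (eval 0) h)
  have hmon (a b c : ZMod 7) : (X ^ 3 + C a * X ^ 2 + C b * X + C c : (ZMod 7)[X]).Monic := by
    monicity!
  have hdvd := Dvd.intro_left _ (hgh.trans pairSumResolvent_zmod_seven).symm
  have hdeg := natDegree_cubic_zmod_seven
  have : Fact (Nat.Prime 7) := ⟨by norm_num⟩
  exact false_of_three_cubics_dvd hg hh irr₁ irr₂ irr₃ (hdeg _ _ _) (hdeg _ _ _) (hdeg _ _ _)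
    (hmon _ _ _) (hmon _ _ _) (hmon _ _ _) (hne (by decide)) (hne (by decide)) (hne (by decide))
    hdvd

lemma irreducible_pairSumResolvent_three : Irreducible (pairSumResolvent X 3 : ℤ[X]) := by
  rw [monic_pairSumResolvent_three.irreducible_iff_natDegree']
  refine ⟨fun h ↦ ?_, fun g h hg hh hgh hd ↦ ?_⟩
  · have := natDegree_pairSumResolvent_three
    rw [h, natDegree_one] at this
    omega
  · have hsum := congr_arg natDegree hgh
    rw [hg.natDegree_mul hh] at hsum
    rw [natDegree_pairSumResolvent_three] at hsum hd
    rw [Finset.mem_Ioc] at hd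
    have hmap (n : ℕ) : g.map (Int.castRingHom (ZMod n)) * h.map (Int.castRingHom (ZMod n)) =
        pairSumResolvent X 3 := by
      rw [← Polynomial.map_mul, hgh, ← coe_mapRingHom, map_pairSumResolvent]
      simp
    have : Fact (Nat.Prime 7) := ⟨by norm_num⟩
    have h5 := natDegree_eq_five_of_mul_eq (hmap 2)
      (by rw [hg.natDegree_map]; omega) (by rw [hh.natDegree_map]; omega)
    rw [hh.natDegree_map] at h5
    exact not_natDegree_eq_five (hmap 7) (by rw [hg.natDegree_map]; omega)
      (by rw [hh.natDegree_map]; omega)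

lemma irreducible_pairSumResolvent_three_rat : Irreducible (pairSumResolvent X 3 : ℚ[X]) := by
  have := (IsPrimitive.Int.irreducible_iff_irreducible_map_cast
    monic_pairSumResolvent_three.isPrimitive).mp irreducible_pairSumResolvent_three
  rw [← coe_mapRingHom, map_pairSumResolvent] at this
  simpa using this

end Polynomial

/-- An irreducible factor, defined over `K`, of a polynomial defined over `k` which passes through
a `k`-rational point where the polynomial does not vanish doubly is defined over `k` up to a
scalar. -/
lemma MvPolynomial.exists_associated_map {σ k K : Type*} [Field k] [Field K] [Algebra k K]
    [IsGalois k K] {p : MvPolynomial σ k} {G : MvPolynomial σ K} (hG : Irreducible G)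
    (hdvd : G ∣ map (algebraMap k K) p) (P : σ → k)
    (hGP : eval (fun i ↦ algebraMap k K (P i)) G = 0)
    (hP : ∀ A B : MvPolynomial σ K, A * B ∣ map (algebraMap k K) p →
      eval (fun i ↦ algebraMap k K (P i)) A = 0 → eval (fun i ↦ algebraMap k K (P i)) B ≠ 0) :
    ∃ g : MvPolynomial σ k, Associated G (map (algebraMap k K) g) := by
  classical
  obtain ⟨d, hd⟩ := ne_zero_iff.mp hG.ne_zero
  have hu : IsUnit (C (coeff d G)⁻¹ : MvPolynomial σ K) :=
    (isUnit_iff_ne_zero.mpr (inv_ne_zero hd)).map C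
  suffices C (coeff d G)⁻¹ * G ∈ Set.range (map (algebraMap k K) : MvPolynomial σ k →+* _) by
    obtain ⟨g, hg⟩ := this
    exact ⟨g, hg ▸ associated_unit_mul_right G _ hu⟩
  rw [mem_range_map_iff_coeffs_subset]
  intro x hx
  obtain ⟨e, -, rfl⟩ := mem_coeffs_iff.mp hx
  rw [InfiniteGalois.mem_range_algebraMap_iff_fixed]
  intro τ
  have hp : map (τ : K →+* K) (map (algebraMap k K) p) = map (algebraMap k K) p := by
    rw [map_map]
    congr 2
    ext x
    simp
  have hirr : Irreducible (map (τ : K →+* K) G) :=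
    (MulEquiv.irreducible_iff (mapEquiv σ (τ : K ≃+* K))).mpr hG
  have hdvd' : map (τ : K →+* K) G ∣ map (algebraMap k K) p := by
    rw [← hp]
    exact map_dvd _ hdvd
  have hGP' : eval (fun i ↦ algebraMap k K (P i)) (map (τ : K →+* K) G) = 0 := by
    have := congr_arg τ hGP
    rw [map_zero] at this
    rw [← this, eval_map, ← eval₂_id]
    change _ = (τ : K →+* K) _
    rw [eval₂_comp_left]
    congr 1
    ext i
    simp
  have hass : Associated (map (τ : K →+* K) G) G := by
    refine hirr.associated_of_dvd hG ?_
    obtain ⟨Q, hQ⟩ := hdvd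
    refine (hirr.prime.dvd_or_dvd (hQ ▸ hdvd')).resolve_right fun h ↦ ?_
    exact hP G _ (hQ ▸ mul_dvd_mul_left G h) hGP hGP'
  obtain ⟨u, hu⟩ := hass.symm
  obtain ⟨c, -, hc⟩ := isUnit_iff_eq_C_of_isReduced.mp u.isUnit
  rw [hc, mul_comm] at hu
  have hcoeff (e : σ →₀ ℕ) : c * coeff e G = τ (coeff e G) := by
    rw [← coeff_C_mul, hu, coeff_map]
    rfl
  have hτ : τ (coeff d G) ≠ 0 := by simpa using hd
  rw [coeff_C_mul, map_mul, map_inv₀, ← hcoeff, ← hcoeff]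
  have hc0 : c ≠ 0 := left_ne_zero_of_mul (hcoeff d ▸ hτ)
  field_simp

/-- Restriction of a polynomial in `z, b₁₁` to the line `b₁₁ = t + 1`, in the coordinate `z + 2`. -/
noncomputable def restrictLine {k : Type*} [Field k] (t : k) :
    MvPolynomial (Fin 2) k →ₐ[k] Polynomial k :=
  aeval ![Polynomial.X - 2, Polynomial.C (t + 1)]

lemma restrictLine_pairSumResolvent {k : Type*} [Field k] (t : k) :
    restrictLine t (pairSumResolvent (X 0 + 2) (X 1 - 1)) =
      pairSumResolvent Polynomial.X (Polynomial.C t) := by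
  rw [map_pairSumResolvent]
  congr 1 <;> simp [restrictLine, map_ofNat (aeval (R := k) _)]

lemma restrictLine_map {k K : Type*} [Field k] [Field K] [Algebra k K] (t : k)
    (g : MvPolynomial (Fin 2) k) :
    restrictLine (algebraMap k K t) (map (algebraMap k K) g) =
      (restrictLine t g).map (algebraMap k K) := by
  induction g using MvPolynomial.induction_on with
  | C a => simp [restrictLine]
  | add p q hp hq => simp [hp, hq]
  | mul_X p i hp =>
    rw [map_mul, map_mul, map_mul, Polynomial.map_mul, hp]
    congr 1
    fin_cases i <;> simp [restrictLine]

lemma natDegree_restrictLine_le {k : Type*} [Field k] (t : k) (g : MvPolynomial (Fin 2) k) :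
    (restrictLine t g).natDegree ≤ g.totalDegree := by
  have h := aeval_natDegree_le g le_rfl ![Polynomial.X - 2, Polynomial.C (t + 1)] (n := 1) ?_
  · rwa [mul_one] at h
  · intro i
    fin_cases i
    · change (Polynomial.X - 2 : Polynomial k).natDegree ≤ 1
      compute_degree
    · simp

lemma eval_restrictLine {k : Type*} [Field k] (t v : k) (g : MvPolynomial (Fin 2) k) :
    (restrictLine t g).eval v = eval ![v - 2, t + 1] g := by
  induction g using MvPolynomial.induction_on with
  | C a => simp [restrictLine]
  | add p q hp hq => simp [hp, hq]
  | mul_X p i hp =>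
    rw [map_mul, map_mul, Polynomial.eval_mul, hp]
    congr 1
    fin_cases i <;> simp [restrictLine]

lemma natDegree_pairSumResolvent_X_C {k : Type*} [Field k] (t : k) :
    (pairSumResolvent Polynomial.X (Polynomial.C t)).natDegree = 10 := by
  unfold pairSumResolvent
  compute_degree!

lemma totalDegree_pairSumResolvent_le {σ R : Type*} [CommRing R] {v t : MvPolynomial σ R}
    (hv : v.totalDegree ≤ 1) (ht : t.totalDegree ≤ 1) :
    (pairSumResolvent v t).totalDegree ≤ 10 := by
  let f (c : ℤ) (i j : ℕ) : MvPolynomial σ R := c * v ^ i * t ^ j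
  have hpow {u : MvPolynomial σ R} (hu : u.totalDegree ≤ 1) (n : ℕ) :
      (u ^ n).totalDegree ≤ n :=
    (totalDegree_pow _ _).trans (by simpa using Nat.mul_le_mul_left n hu)
  have hf (c : ℤ) (i j : ℕ) (hij : i + j ≤ 10) : (f c i j).totalDegree ≤ 10 := by
    have hc : (c : MvPolynomial σ R).totalDegree = 0 := by
      rw [← map_intCast (C : R →+* MvPolynomial σ R) c, totalDegree_C]
    have h₁ := totalDegree_mul ((c : MvPolynomial σ R) * v ^ i) (t ^ j)
    have h₂ := totalDegree_mul (c : MvPolynomial σ R) (v ^ i)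
    have h₃ := hpow hv i
    have h₄ := hpow ht j
    exact h₁.trans (by omega)
  have hadd {a b : MvPolynomial σ R} (ha : a.totalDegree ≤ 10) (hb : b.totalDegree ≤ 10) :
      (a + b).totalDegree ≤ 10 := (totalDegree_add _ _).trans (max_le ha hb)
  have h : pairSumResolvent v t =
      f 1 10 0 + f 4 9 1 + f 6 8 2 + f (-12) 8 0 + f 4 7 3 + f (-39) 7 1 + f 1 6 4 + f (-48) 6 2
        + f 39 6 0 + f (-27) 5 3 + f 94 5 1 + f (-6) 4 4 + f 83 4 2 + f (-40) 4 0 + f 32 3 3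
        + f (-60) 3 1 + f 5 2 4 + f (-30) 2 2 + f 12 2 0 + f (-5) 1 3 + f 8 1 1 + f 1 0 2 := by
    simp only [f, pairSumResolvent]
    push_cast
    ring
  rw [h]
  repeat' with_reducible apply hadd
  all_goals exact hf _ _ _ (by norm_num)

lemma totalDegree_pairSumResolvent {k : Type*} [Field k] :
    (pairSumResolvent (X 0 + 2) (X 1 - 1) : MvPolynomial (Fin 2) k).totalDegree = 10 := by
  apply le_antisymm
  · have hC (c : k) (n : ℕ) : (C c : MvPolynomial (Fin 2) k).totalDegree ≤ n := by
      simp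
    have hv : (X 0 + 2 : MvPolynomial (Fin 2) k).totalDegree ≤ 1 :=
      (totalDegree_add _ _).trans (max_le (totalDegree_X _).le (hC 2 1))
    have ht : (X 1 - 1 : MvPolynomial (Fin 2) k).totalDegree ≤ 1 :=
      (totalDegree_sub _ _).trans (max_le (totalDegree_X _).le (hC 1 1))
    exact totalDegree_pairSumResolvent_le hv ht
  · have := natDegree_restrictLine_le (0 : k) (pairSumResolvent (X 0 + 2) (X 1 - 1))
    rwa [restrictLine_pairSumResolvent, natDegree_pairSumResolvent_X_C] at this

lemma not_double_zero {k : Type*} [Field k] [CharZero k] {A B : MvPolynomial (Fin 2) k}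
    (h : A * B ∣ pairSumResolvent (X 0 + 2) (X 1 - 1)) (hA : eval ![-1, 1] A = 0) :
    eval ![-1, 1] B ≠ 0 := by
  intro hB
  have he (g : MvPolynomial (Fin 2) k) (hg : eval ![-1, 1] g = 0) :
      Polynomial.X - Polynomial.C 1 ∣ restrictLine 0 g := by
    rw [Polynomial.dvd_iff_isRoot, Polynomial.IsRoot, eval_restrictLine]
    convert hg using 3
    norm_num
  have hd := map_dvd (restrictLine (0 : k)) h
  rw [map_mul, restrictLine_pairSumResolvent] at hd
  obtain ⟨q, hq⟩ := (mul_dvd_mul (he A hA) (he B hB)).trans hd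
  have := congr_arg (fun p ↦ (Polynomial.derivative p).eval 1) hq
  simp [pairSumResolvent] at this
  norm_num at this

lemma irreducible_pairSumResolvent {K : Type*} [Field K] [Algebra ℚ K] [IsGalois ℚ K] :
    Irreducible (pairSumResolvent (X 0 + 2) (X 1 - 1) : MvPolynomial (Fin 2) K) := by
  have : CharZero K := algebraRat.charZero K
  set Φ : MvPolynomial (Fin 2) K := pairSumResolvent (X 0 + 2) (X 1 - 1) with hΦ
  set p : MvPolynomial (Fin 2) ℚ := pairSumResolvent (X 0 + 2) (X 1 - 1) with hp
  have hpΦ : map (algebraMap ℚ K) p = Φ := by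
    rw [hp, hΦ, map_pairSumResolvent]
    congr 1 <;> simp [map_ofNat (map _)]
  have hdeg : Φ.totalDegree = 10 := totalDegree_pairSumResolvent
  have h0 : Φ ≠ 0 := by
    rintro h
    simp [h] at hdeg
  have hev : eval ![-1, 1] Φ = 0 := by
    rw [hΦ, map_pairSumResolvent]
    simp only [map_add, map_sub, eval_X, map_one, map_ofNat, pairSumResolvent]
    simp
    norm_num
  obtain ⟨G, hG, hGΦ, hGP⟩ : ∃ G, Irreducible G ∧ G ∣ Φ ∧ eval ![-1, 1] G = 0 := by
    obtain ⟨s, hs, hsΦ⟩ := WfDvdMonoid.exists_factors Φ h0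
    have hs0 : eval ![-1, 1] s.prod = 0 := by
      obtain ⟨u, hu⟩ := hsΦ.symm
      rw [← hu, map_mul, hev, zero_mul]
    rw [map_multiset_prod, Multiset.prod_eq_zero_iff, Multiset.mem_map] at hs0
    obtain ⟨G, hGs, hG⟩ := hs0
    exact ⟨G, hs G hGs, (Multiset.dvd_prod hGs).trans hsΦ.dvd, hG⟩
  have hpt : (fun i ↦ algebraMap ℚ K ((![-1, 1] : Fin 2 → ℚ) i)) = ![-1, 1] := by
    ext i
    fin_cases i <;> simp
  obtain ⟨g, hg⟩ := exists_associated_map (p := p) hG (hpΦ ▸ hGΦ) ![-1, 1] (by rwa [hpt])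
    (by rw [hpt, hpΦ]; exact fun A B h ↦ not_double_zero h)
  obtain ⟨H, hH⟩ := hg.symm.dvd.trans hGΦ
  have hgi := hg.irreducible hG
  have hHne : H ≠ 0 := right_ne_zero_of_mul (hH ▸ h0)
  have hsum : (map (algebraMap ℚ K) g).totalDegree + H.totalDegree = 10 := by
    rw [← totalDegree_mul_of_isDomain hgi.ne_zero hHne, ← hH, hdeg]
  obtain ⟨q, hq⟩ : restrictLine 3 g ∣ pairSumResolvent Polynomial.X (Polynomial.C 3) := by
    rw [← Polynomial.map_dvd_map' (algebraMap ℚ K), ← restrictLine_map,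
      ← restrictLine_pairSumResolvent, ← restrictLine_map, ← hp, hpΦ]
    exact map_dvd _ (Dvd.intro _ hH.symm)
  have hdegq := congr_arg Polynomial.natDegree hq
  rw [natDegree_pairSumResolvent_X_C] at hdegq
  have hdegH := congr_arg (fun r ↦ (restrictLine (algebraMap ℚ K 3) r).natDegree) hH
  simp only [hΦ, restrictLine_pairSumResolvent, natDegree_pairSumResolvent_X_C, map_mul,
    restrictLine_map] at hdegH
  have hle₁ := hdegq.trans_le Polynomial.natDegree_mul_le
  have hle₂ := hdegH.trans_le Polynomial.natDegree_mul_le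
  rw [Polynomial.natDegree_map] at hle₂
  have hleH := natDegree_restrictLine_le (algebraMap ℚ K 3) H
  have hleg := natDegree_restrictLine_le (algebraMap ℚ K 3) (map (algebraMap ℚ K) g)
  rw [restrictLine_map, Polynomial.natDegree_map] at hleg
  have isUnit_of_totalDegree {A : MvPolynomial (Fin 2) K} (hA : A ≠ 0) (hd : A.totalDegree = 0) :
      IsUnit A := by
    rw [totalDegree_eq_zero_iff_eq_C] at hd
    rw [hd, ne_eq, C_eq_zero] at hA
    rw [hd]
    exact (isUnit_iff_ne_zero.mpr hA).map C
  have h3 : (Polynomial.C 3 : Polynomial ℚ) = 3 := map_ofNat _ 3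
  obtain hu | hu := (h3 ▸ Polynomial.irreducible_pairSumResolvent_three_rat).isUnit_or_isUnit hq
  · have := Polynomial.natDegree_eq_zero_of_isUnit hu
    exact absurd (isUnit_of_totalDegree hgi.ne_zero (by omega)) hgi.not_isUnit
  · have := Polynomial.natDegree_eq_zero_of_isUnit hu
    rw [hH]
    exact (associated_mul_isUnit_right_iff (isUnit_of_totalDegree hHne (by omega))).mpr
      (Associated.refl _) |>.irreducible hgi

/-- Any polynomial `Φ` in the two variables `z` (variable `0`) and `b₁₁` (variable `1`)
which specializes, for all values of `b₁₁` and every root enumeration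
`det(λ·Id₅ + B₀(b₁₁)) = ∏ᵢ (λ + αᵢ)`, to `∏_{i<j} (z + αᵢ + αⱼ)` — i.e. the resolvent
`Φ(z; Id₅, B₀(b₁₁))` — is irreducible of total degree `10` over `ℚ̄`. -/
theorem resolvent_B0_absolutely_irreducible (Φ : MvPolynomial (Fin 2) Qbar)
    (hΦ : ∀ b z : Qbar, ∀ α : Fin 5 → Qbar,
      Matrix.det (Matrix.of fun i j =>
          (if i = j then Polynomial.X else 0) + Polynomial.C (B0 b i j)) =
        ∏ i : Fin 5, (Polynomial.X + Polynomial.C (α i)) →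
      MvPolynomial.eval ![z, b] Φ =
        ∏ i : Fin 5, ∏ j ∈ Finset.Ioi i, (z + α i + α j)) :
    Irreducible Φ ∧ Φ.totalDegree = 10 := by
  rw [eq_map_pairSumResolvent Φ hΦ]
  let A : Algebra ℚ Qbar := AlgebraicClosure.instAlgebra ℚ
  have hgal : @IsGalois ℚ _ Qbar _ A :=
    @IsAlgClosure.isGalois ℚ Qbar _ _ A ⟨inferInstance, AlgebraicClosure.isAlgebraic ℚ⟩ _
  exact ⟨@irreducible_pairSumResolvent Qbar _ A hgal, totalDegree_pairSumResolvent⟩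
end

section
/- Let G(x,y) ∈ ℤ[x,y] be a polynomial of total degree d that is irreducible over the algebraic closure of ℚ, and let N ≥ exp(d^6) be an integer. Then the number of pairs (x,y) ∈ (ℤ ∩ [0,N])² with G(x,y) = 0 is at most N^{1/d} · exp(12·√(d · log N · log log N)). -/
theorem finTwo_finsupp_sum (n : Fin 2 →₀ ℕ) : (n.sum fun _ e => e) = n 0 + n 1 := by
  rw [Finsupp.sum_fintype _ _ (fun _ => rfl), Fin.sum_univ_two]

open MvPolynomial in
/-- The dimension of the space of bivariate polynomials of total degree at most `k`. -/
theorem two_mul_finrank_restrictTotalDegree (K : Type*) [Field K] (k : ℕ) :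
    2 * Module.finrank K (restrictTotalDegree (Fin 2) K k) = (k + 1) * (k + 2) := by
  have h : Module.finrank K (restrictTotalDegree (Fin 2) K k)
      = Nat.card {n : Fin 2 →₀ ℕ | (n.sum fun _ e => e) ≤ k} :=
    Module.finrank_eq_nat_card_basis (basisRestrictSupport K _)
  let e : {n : Fin 2 →₀ ℕ | (n.sum fun _ e => e) ≤ k} ≃
      ((Finset.range (k + 1)).sigma fun a => Finset.range (k + 1 - a)) :=
    { toFun := fun n => ⟨⟨n.1 0, n.1 1⟩, by
        have := n.2
        simp only [Set.mem_ofPred_eq, finTwo_finsupp_sum] at this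
        simp only [Finset.mem_sigma, Finset.mem_range]
        omega⟩
      invFun := fun q => ⟨Finsupp.equivFunOnFinite.symm ![q.1.1, q.1.2], by
        have := q.2
        simp only [Finset.mem_sigma, Finset.mem_range] at this
        simp only [Set.mem_ofPred_eq, finTwo_finsupp_sum]
        simp
        omega⟩
      left_inv := fun n => by
        ext i
        fin_cases i <;> simp
      right_inv := fun q => by
        ext <;> simp }
  rw [h, Nat.card_congr e]
  simp only [Nat.card_eq_fintype_card, Fintype.card_coe, Finset.card_sigma, Finset.card_range]
  rw [← Finset.sum_range_reflect]
  have : ∑ j ∈ Finset.range (k + 1), (k + 1 - (k + 1 - 1 - j))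
      = ∑ j ∈ Finset.range (k + 1), (j + 1) :=
    Finset.sum_congr rfl fun j hj => by
      have := Finset.mem_range.1 hj
      omega
  rw [this, Finset.sum_add_distrib, mul_add, mul_comm, Finset.sum_range_id_mul_two]
  simp
  ring

open MvPolynomial in
/-- A finite set of points in the plane admits a polynomial of degree at most its cardinality
which separates a given point from all the others. -/
theorem exists_separating_polynomial {K : Type*} [Field K] (S : Finset (Fin 2 → K))
    (P : Fin 2 → K) :
    ∃ F : MvPolynomial (Fin 2) K, F.totalDegree ≤ S.card ∧ eval P F ≠ 0 ∧
      ∀ Q ∈ S, Q ≠ P → eval Q F = 0 := by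
  classical
  have key : ∀ Q : Fin 2 → K, ∃ F : MvPolynomial (Fin 2) K, F.totalDegree ≤ 1 ∧ eval P F ≠ 0 ∧
      (Q ≠ P → eval Q F = 0) := by
    intro Q
    by_cases h : Q = P
    · exact ⟨1, by simp, by simp, fun h' => absurd h h'⟩
    · obtain ⟨i, hi⟩ := Function.ne_iff.1 h
      refine ⟨X i - C (Q i), ?_, ?_, ?_⟩
      · refine (totalDegree_sub _ _).trans ?_
        simp
      · simpa [sub_eq_zero] using fun h => hi h.symm
      · simp
  choose F hF using key
  refine ⟨∏ Q ∈ S, F Q, ?_, ?_, ?_⟩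
  · refine (totalDegree_finsetProd _ _).trans ?_
    refine (Finset.sum_le_card_nsmul _ _ 1 fun Q _ => (hF Q).1).trans (by simp)
  · rw [map_prod]
    exact Finset.prod_ne_zero_iff.2 fun Q _ => (hF Q).2.1
  · intro Q hQ hne
    rw [map_prod]
    exact Finset.prod_eq_zero hQ ((hF Q).2.2 hne)

open MvPolynomial in
/-- Bézout's inequality for an irreducible plane curve. -/
theorem card_common_zeros_le {K : Type*} [Field K] {G H : MvPolynomial (Fin 2) K}
    (hG : Irreducible G) (hGH : ¬ G ∣ H) (S : Finset (Fin 2 → K))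
    (hS : ∀ P ∈ S, eval P G = 0 ∧ eval P H = 0) :
    S.card ≤ G.totalDegree * H.totalDegree := by
  classical
  have hG0 : G ≠ 0 := hG.ne_zero
  have hH0 : H ≠ 0 := fun h => hGH (h ▸ dvd_zero G)
  set d := G.totalDegree with hd
  set e := H.totalDegree with he
  set m := S.card with hm
  let V : ℕ → Submodule K (MvPolynomial (Fin 2) K) := restrictTotalDegree (Fin 2) K
  let mulBy : MvPolynomial (Fin 2) K → MvPolynomial (Fin 2) K →ₗ[K] MvPolynomial (Fin 2) K :=
    fun F => LinearMap.mulLeft K F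
  have hinj : ∀ F : MvPolynomial (Fin 2) K, F ≠ 0 → Function.Injective (mulBy F) :=
    fun F hF a b hab => mul_left_cancel₀ hF hab
  have hfr : ∀ F : MvPolynomial (Fin 2) K, F ≠ 0 → ∀ k,
      2 * Module.finrank K ((V k).map (mulBy F)) = (k + 1) * (k + 2) := by
    intro F hF k
    rw [← two_mul_finrank_restrictTotalDegree K k]
    congr 1
    exact (Submodule.equivMapOfInjective _ (hinj F hF) (V k)).finrank_eq.symm
  have hle : ∀ (F : MvPolynomial (Fin 2) K) (k : ℕ),
      (V k).map (mulBy F) ≤ V (F.totalDegree + k) := by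
    rintro F k _ ⟨q, hq, rfl⟩
    have hq' := (mem_restrictTotalDegree _ _ q).1 hq
    exact (mem_restrictTotalDegree _ _ _).2 ((totalDegree_mul _ _).trans (by omega))
  let A := (V (m + e)).map (mulBy G)
  let B := (V (m + d)).map (mulBy H)
  have hA : A ≤ V (m + d + e) := (hle G (m + e)).trans (by rw [← hd]; apply le_of_eq; congr 1; ring)
  have hB : B ≤ V (m + d + e) := (hle H (m + d)).trans (by rw [← he]; apply le_of_eq; congr 1; ring)
  have : ∀ k, Module.Finite K (V k) := fun k => by
    change Module.Finite K (restrictTotalDegree (Fin 2) K k)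
    infer_instance
  have : Module.Finite K A := Module.Finite.map _ _
  have : Module.Finite K B := Module.Finite.map _ _
  have hinf : A ⊓ B ≤ (V m).map (mulBy (G * H)) := by
    rintro _ ⟨⟨q, hq, rfl⟩, ⟨r, hr, hqr⟩⟩
    have hqr' : H * r = G * q := hqr
    have hdvd : G ∣ r := (hG.prime.dvd_or_dvd ⟨q, hqr'⟩).resolve_left hGH
    obtain ⟨t, rfl⟩ := hdvd
    refine ⟨t, ?_, ?_⟩
    · refine (mem_restrictTotalDegree _ _ _).2 ?_
      by_cases ht : t = 0
      · simp [ht]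
      have := (mem_restrictTotalDegree _ _ _).1 hr
      rw [totalDegree_mul_of_isDomain hG0 ht] at this
      omega
    · change G * H * t = G * q
      rw [← hqr']
      ring
  let ev : MvPolynomial (Fin 2) K →ₗ[K] (S → K) :=
    LinearMap.pi fun P => (aeval (R := K) P.1).toLinearMap
  have hev : ∀ (F : MvPolynomial (Fin 2) K) (P : S), ev F P = eval P.1 F := fun F P => by
    simp [ev, aeval_eq_eval]
  let evk : V (m + d + e) →ₗ[K] (S → K) := ev.comp (V (m + d + e)).subtype
  have hsurj : Function.Surjective evk := by
    choose F hF using exists_separating_polynomial S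
    intro f
    have hmem : ∑ P : S, (f P / eval P.1 (F P)) • F P ∈ V (m + d + e) := by
      refine Submodule.sum_mem _ fun P _ => Submodule.smul_mem _ _ ?_
      exact (mem_restrictTotalDegree _ _ _).2 ((hF P).1.trans (by omega))
    refine ⟨⟨_, hmem⟩, ?_⟩
    funext Q
    change ev (∑ P : S, (f P / eval P.1 (F P)) • F P) Q = _
    rw [hev, map_sum, Finset.sum_eq_single Q]
    · simp [smul_eval, div_mul_cancel₀ _ (hF Q.1).2.1]
    · intro P _ hPQ
      rw [smul_eval, (hF P.1).2.2 Q.1 Q.2 (fun h => hPQ (Subtype.ext h.symm)), mul_zero]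
    · simp
  have hker : A ⊔ B ≤ (LinearMap.ker evk).map (V (m + d + e)).subtype := by
    rw [sup_le_iff]
    constructor
    · intro F hF
      refine ⟨⟨F, hA hF⟩, ?_, rfl⟩
      obtain ⟨q, -, rfl⟩ := hF
      refine LinearMap.mem_ker.2 (funext fun P => ?_)
      change ev _ P = 0
      rw [hev]
      change eval P.1 (G * q) = 0
      rw [map_mul, (hS P.1 P.2).1, zero_mul]
    · intro F hF
      refine ⟨⟨F, hB hF⟩, ?_, rfl⟩
      obtain ⟨q, -, rfl⟩ := hF
      refine LinearMap.mem_ker.2 (funext fun P => ?_)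
      change ev _ P = 0
      rw [hev]
      change eval P.1 (H * q) = 0
      rw [map_mul, (hS P.1 P.2).2, zero_mul]
  have h1 := LinearMap.finrank_range_add_finrank_ker evk
  rw [LinearMap.range_eq_top.2 hsurj, finrank_top, Module.finrank_pi, Fintype.card_coe] at h1
  have h2 := Submodule.finrank_mono hker
  have h3 : Module.finrank K ((LinearMap.ker evk).map (V (m + d + e)).subtype)
      = Module.finrank K (LinearMap.ker evk) :=
    (Submodule.equivMapOfInjective _ (Submodule.subtype_injective _) _).finrank_eq.symm
  have h4 := Submodule.finrank_sup_add_finrank_inf_eq A B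
  have h5 := Submodule.finrank_mono hinf
  have h6 := hfr G hG0 (m + e)
  have h7 := hfr H hH0 (m + d)
  have h8 := hfr (G * H) (mul_ne_zero hG0 hH0) m
  have h9 : 2 * Module.finrank K (V (m + d + e)) = _ :=
    two_mul_finrank_restrictTotalDegree K (m + d + e)
  change 2 * Module.finrank K A = _ at h6
  change 2 * Module.finrank K B = _ at h7
  nlinarith

/-- The exponents of `D` consecutive layers of monomials of total degree at least `a + b` which
are not divisible by `x ^ a * y ^ b`. -/
noncomputable def layerExponent (a b : ℕ) {D : ℕ} : Fin D × (Fin a ⊕ Fin b) → Fin 2 →₀ ℕ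
  | (i, .inl j) => Finsupp.equivFunOnFinite.symm ![j, a + b + i - j]
  | (i, .inr j) => Finsupp.equivFunOnFinite.symm ![a + b + i - j, j]

theorem layerExponent_injective (a b D : ℕ) :
    Function.Injective (layerExponent a b : Fin D × (Fin a ⊕ Fin b) → Fin 2 →₀ ℕ) := by
  rintro ⟨i, j | j⟩ ⟨i', j' | j'⟩ h <;>
  · have h0 := DFunLike.congr_fun h 0
    have h1 := DFunLike.congr_fun h 1
    simp [layerExponent] at h0 h1
    try simp [Fin.ext_iff]
    omega

theorem layerExponent_add {a b D : ℕ} (q : Fin D × (Fin a ⊕ Fin b)) :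
    layerExponent a b q 0 + layerExponent a b q 1 = a + b + q.1 := by
  rcases q with ⟨i, j | j⟩ <;> simp [layerExponent] <;> omega

theorem layerExponent_lt {a b D : ℕ} (q : Fin D × (Fin a ⊕ Fin b)) :
    layerExponent a b q 0 < a ∨ layerExponent a b q 1 < b := by
  rcases q with ⟨i, j | j⟩ <;> simp [layerExponent]

open MvPolynomial MonomialOrder in
/-- For every nonzero `G` of total degree `d` there is a way to write `d = a + b` such that no
nontrivial combination of the monomials `layerExponent a b` is divisible by `G`. -/
theorem exists_layerExponent_not_dvd {K : Type*} [Field K] {G : MvPolynomial (Fin 2) K}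
    (hG : G ≠ 0) :
    ∃ a b : ℕ, a + b = G.totalDegree ∧ ∀ (D : ℕ) (c : Fin D × (Fin a ⊕ Fin b) → K), c ≠ 0 →
      ¬ G ∣ ∑ q, monomial (layerExponent a b q) (c q) := by
  classical
  refine ⟨degLex.degree G 0, degLex.degree G 1, ?_, ?_⟩
  · rw [← degree_degLexDegree, Finsupp.degree_eq_sum, Fin.sum_univ_two]
  · rintro D c hc ⟨Q, hQ⟩
    generalize ha : degLex.degree G 0 = a at *
    generalize hb : degLex.degree G 1 = b at *
    have hcoeff : ∀ q, coeff (layerExponent a b q)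
        (∑ q, monomial (layerExponent a b q) (c q)) = c q := by
      intro q
      rw [coeff_sum, Finset.sum_eq_single q]
      · simp
      · intro r _ hr
        rw [coeff_monomial, if_neg fun h => hr (layerExponent_injective a b D h)]
      · simp
    have h0 : ∑ q, monomial (layerExponent a b q) (c q) ≠ 0 := by
      intro h
      apply hc
      funext q
      rw [← hcoeff q, h]
      simp
    have hQ0 : Q ≠ 0 := by
      rintro rfl
      exact h0 (by rw [hQ, mul_zero])
    have hmem := degLex.degree_mem_support h0
    have hdeg : degLex.degree (∑ q, monomial (layerExponent a b q) (c q))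
        = degLex.degree G + degLex.degree Q := by
      rw [hQ, degLex.degree_mul hG hQ0]
    obtain ⟨q, -, hq⟩ := Finset.mem_biUnion.1 (support_sum hmem)
    have hq' := Finset.mem_singleton.1 (support_monomial_subset hq)
    rw [hq'] at hdeg
    have e0 := DFunLike.congr_fun hdeg 0
    have e1 := DFunLike.congr_fun hdeg 1
    simp only [Finsupp.add_apply] at e0 e1
    have := layerExponent_lt q
    omega

/-- If all maximal minors of a family of row vectors vanish, then the family lies in a
hyperplane. -/
theorem exists_ne_zero_of_forall_det_eq_zero {K ι α : Type*} [Field K] [Fintype ι] [DecidableEq ι]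
    (v : α → ι → K) (h : ∀ P : ι → α, (Matrix.of fun i j => v (P i) j).det = 0) :
    ∃ c : ι → K, c ≠ 0 ∧ ∀ x, ∑ j, c j * v x j = 0 := by
  by_cases htop : Submodule.span K (Set.range v) = ⊤
  · exfalso
    obtain ⟨κ, a, -, hspan, hli⟩ := exists_linearIndependent' K v
    rw [htop] at hspan
    let B := Module.Basis.mk hli hspan.ge
    let e : ι ≃ κ := (Pi.basisFun K ι).indexEquiv B
    have hli' : LinearIndependent K fun i => v (a (e i)) := hli.comp e e.injective
    have hu := Matrix.linearIndependent_rows_iff_isUnit (A := Matrix.of fun i j => v (a (e i)) j)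
      |>.1 hli'
    rw [Matrix.isUnit_iff_isUnit_det, h fun i => a (e i)] at hu
    exact not_isUnit_zero hu
  · obtain ⟨f, hf, hker⟩ := Submodule.exists_le_ker_of_lt_top _ (lt_top_iff_ne_top.2 htop)
    have hfv : ∀ w, f w = ∑ j, f (Pi.single j 1) * w j := by
      intro w
      rw [f.pi_apply_eq_sum_univ w]
      refine Finset.sum_congr rfl fun j _ => ?_
      rw [smul_eq_mul, mul_comm]
      congr 2
      funext i
      simp [Pi.single_apply, eq_comm]
    refine ⟨fun j => f (Pi.single j 1), ?_, fun x => ?_⟩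
    · intro h0
      apply hf
      ext j
      simpa using congrFun h0 j
    · rw [← hfv]
      exact hker (Submodule.subset_span ⟨x, rfl⟩)

/-- The sum of `s` distinct natural numbers is at least `0 + 1 + ⋯ + (s - 1)`. -/
theorem sum_range_card_le_sum {ι : Type*} [Fintype ι] (r : ι → ℕ) (hr : Function.Injective r) :
    ∑ i ∈ Finset.range (Fintype.card ι), i ≤ ∑ i, r i := by
  classical
  have key : ∀ A : Finset ℕ, ∑ i ∈ Finset.range A.card, i ≤ ∑ i ∈ A, i := by
    intro A
    induction A using Finset.induction_on_max with
    | empty => simp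
    | insert m A hA ih =>
      have hm : m ∉ A := fun h => lt_irrefl _ (hA m h)
      rw [Finset.card_insert_of_notMem hm, Finset.sum_insert hm, Finset.sum_range_succ, add_comm]
      have : A.card ≤ m := by
        simpa using Finset.card_le_card
          (fun x hx => Finset.mem_range.2 (hA x hx) : A ⊆ Finset.range m)
      omega
  have h := key (Finset.univ.map ⟨r, hr⟩)
  simpa using h

open Polynomial in
/-- The determinant of a matrix of values of integer polynomials at multiples of `p` is divisible
by a high power of `p`. -/
theorem pow_dvd_det_polynomial_eval {ι : Type*} [Fintype ι] [DecidableEq ι] (p : ℤ) (t : ι → ℤ)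
    (ht : ∀ i, p ∣ t i) (h : ι → ℤ[X]) :
    p ^ (∑ i ∈ Finset.range (Fintype.card ι), i) ∣
      (Matrix.of fun i j => (h j).eval (t i)).det := by
  choose τ hτ using ht
  set n := (Finset.univ.sup fun j => (h j).natDegree) + 1 with hn
  have hrow : (Matrix.of fun i j => (h j).eval (t i)).det =
      Matrix.detRowAlternating (fun j => ∑ k : Fin n, (h j).coeff k • fun i => t i ^ (k : ℕ)) := by
    rw [← Matrix.det_transpose]
    change Matrix.det _ = Matrix.det _
    congr 1
    ext j i
    have hlt : (h j).natDegree < n :=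
      Nat.lt_succ_of_le (Finset.le_sup (f := fun j => (h j).natDegree) (Finset.mem_univ j))
    rw [Matrix.transpose_apply, Matrix.of_apply, eval_eq_sum_range' hlt, Finset.sum_range]
    simp
  rw [hrow]
  have hsum := MultilinearMap.map_sum
    (Matrix.detRowAlternating (R := ℤ) (n := ι)).toMultilinearMap
    (fun j (k : Fin n) => (h j).coeff k • fun i => t i ^ (k : ℕ))
  rw [AlternatingMap.coe_multilinearMap] at hsum
  rw [hsum]
  refine Finset.dvd_sum fun r _ => ?_
  rw [← AlternatingMap.coe_multilinearMap, MultilinearMap.map_smul_univ]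
  refine Dvd.dvd.mul_left ?_ _
  by_cases hr : Function.Injective r
  · have : (fun j => (fun i => t i ^ (r j : ℕ) : ι → ℤ))
        = fun j => p ^ (r j : ℕ) • fun i => τ i ^ (r j : ℕ) := by
      funext j i
      simp [hτ, mul_pow]
    rw [this, MultilinearMap.map_smul_univ, Finset.prod_pow_eq_pow_sum]
    refine Dvd.dvd.mul_right (pow_dvd_pow p ?_) _
    exact sum_range_card_le_sum (fun j => (r j : ℕ)) (Fin.val_injective.comp hr)
  · obtain ⟨j, j', hjj, hne⟩ : ∃ j j', r j = r j' ∧ j ≠ j' := by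
      simpa [Function.Injective] using hr
    rw [AlternatingMap.coe_multilinearMap]
    rw [AlternatingMap.map_eq_zero_of_eq _ _ (by simp only [hjj]) hne]
    exact dvd_zero _

/-- Determinants of congruent matrices are congruent. -/
theorem dvd_det_sub_det {ι : Type*} [Fintype ι] [DecidableEq ι] (q : ℤ) (A B : Matrix ι ι ℤ)
    (h : ∀ i j, q ∣ A i j - B i j) : q ∣ A.det - B.det := by
  rw [← Ideal.mem_span_singleton, ← Ideal.Quotient.eq, RingHom.map_det, RingHom.map_det]
  congr 1
  ext i j
  exact Ideal.Quotient.eq.2 (Ideal.mem_span_singleton.2 (h i j))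

open MvPolynomial in
/-- The restriction of a bivariate polynomial to the vertical line through `x`. -/
noncomputable def verticalSlice {R : Type*} [CommRing R] (x : R) :
    MvPolynomial (Fin 2) R →ₐ[R] Polynomial R :=
  aeval ![Polynomial.C x, Polynomial.X]

open MvPolynomial in
theorem eval_verticalSlice {R : Type*} [CommRing R] (x y : R) (G : MvPolynomial (Fin 2) R) :
    (verticalSlice x G).eval y = eval ![x, y] G := by
  induction G using MvPolynomial.induction_on with
  | C a => simp [verticalSlice]
  | add f g hf hg => simp [hf, hg]
  | mul_X f i hf =>
    rw [map_mul, Polynomial.eval_mul, hf, map_mul]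
    congr 1
    fin_cases i <;> simp [verticalSlice]

open MvPolynomial in
theorem derivative_verticalSlice {R : Type*} [CommRing R] (x : R) (G : MvPolynomial (Fin 2) R) :
    Polynomial.derivative (verticalSlice x G) = verticalSlice x (pderiv 1 G) := by
  induction G using MvPolynomial.induction_on with
  | C a => simp [verticalSlice]
  | add f g hf hg => simp [hf, hg]
  | mul_X f i hf =>
    rw [map_mul, Polynomial.derivative_mul, hf, pderiv_mul, map_add, map_mul, map_mul]
    congr 2
    fin_cases i <;> simp [verticalSlice, pderiv_X]

open MvPolynomial in
theorem dvd_eval_sub_eval (F : MvPolynomial (Fin 2) ℤ) {p x y x' y' : ℤ} (hx : p ∣ x - x')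
    (hy : p ∣ y - y') : p ∣ eval ![x, y] F - eval ![x', y'] F := by
  rw [← eval_verticalSlice, ← eval_verticalSlice]
  have h1 : p ∣ (verticalSlice x F).eval y - (verticalSlice x F).eval y' :=
    hy.trans (Polynomial.sub_dvd_eval_sub _ _ _)
  have h2 : p ∣ (verticalSlice x F).eval y' - (verticalSlice x' F).eval y' := by
    rw [eval_verticalSlice, eval_verticalSlice]
    induction F using MvPolynomial.induction_on with
    | C a => simp
    | add f g hf hg =>
      have := dvd_add (hf (hy.trans (Polynomial.sub_dvd_eval_sub _ _ _)))
        (hg (hy.trans (Polynomial.sub_dvd_eval_sub _ _ _)))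
      rw [map_add, map_add]
      exact this.trans (dvd_of_eq (by ring))
    | mul_X f i hf =>
      have hf' := hf (hy.trans (Polynomial.sub_dvd_eval_sub _ _ _))
      rw [map_mul, map_mul]
      fin_cases i
      · have := dvd_add (hf'.mul_right x) (hx.mul_left (eval ![x', y'] f))
        simp
        exact this.trans (dvd_of_eq (by ring))
      · have := hf'.mul_right y'
        simp
        exact this.trans (dvd_of_eq (by ring))
  exact (dvd_add h1 h2).trans (dvd_of_eq (by ring))

open MvPolynomial in
/-- A quantitative Hensel lemma: near a zero of `G` modulo `p` at which `∂G/∂y` is invertible, the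
second coordinate of a zero of `G` is modulo every power of `p` a polynomial in the first. -/
theorem exists_polynomial_parametrization (G : MvPolynomial (Fin 2) ℤ) {p x₀ y₀ b : ℤ}
    (hb : p ∣ 1 - b * eval ![x₀, y₀] (pderiv 1 G)) (m : ℕ) :
    ∃ f : Polynomial ℤ, ∀ x y, p ∣ x - x₀ → p ∣ y - y₀ → eval ![x, y] G = 0 →
      p ^ (m + 1) ∣ y - f.eval (x - x₀) := by
  induction m with
  | zero => exact ⟨Polynomial.C y₀, fun x y _ hy _ => by simpa using hy⟩
  | succ m ih =>
    obtain ⟨f, hf⟩ := ih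
    refine ⟨f - Polynomial.C b * aeval ![Polynomial.X + Polynomial.C x₀, f] G,
      fun x y hx hy hG => ?_⟩
    have hcomp : (aeval ![Polynomial.X + Polynomial.C x₀, f] G : Polynomial ℤ).eval (x - x₀)
        = eval ![x, f.eval (x - x₀)] G := by
      clear hG hf hb
      induction G using MvPolynomial.induction_on with
      | C a => simp
      | add f g hf hg => simp only [map_add, Polynomial.eval_add, hf, hg]
      | mul_X f i hf =>
        rw [map_mul, Polynomial.eval_mul, hf, map_mul]
        congr 1
        fin_cases i <;> simp
    obtain ⟨e, he⟩ := hf x y hx hy hG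
    obtain ⟨k, hk⟩ := (verticalSlice x G).binomExpansion y (-(y - f.eval (x - x₀)))
    rw [show y + -(y - f.eval (x - x₀)) = f.eval (x - x₀) by ring, eval_verticalSlice,
      eval_verticalSlice, hG, derivative_verticalSlice, eval_verticalSlice] at hk
    rw [Polynomial.eval_sub, Polynomial.eval_mul, Polynomial.eval_C, hcomp, hk]
    obtain ⟨u, hu⟩ : p ∣ 1 - b * eval ![x, y] (pderiv 1 G) := by
      have := (dvd_eval_sub_eval (pderiv 1 G) hx hy).mul_left b
      exact (dvd_sub hb this).trans (dvd_of_eq (by ring))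
    refine ⟨e * u + b * k * p ^ m * e ^ 2, ?_⟩
    calc y - (f.eval (x - x₀) - b * (0 + eval ![x, y] (pderiv 1 G) * -(y - f.eval (x - x₀))
            + k * (-(y - f.eval (x - x₀))) ^ 2))
        = (y - f.eval (x - x₀)) * (1 - b * eval ![x, y] (pderiv 1 G))
            + b * k * (y - f.eval (x - x₀)) ^ 2 := by ring
      _ = p ^ (m + 1 + 1) * (e * u + b * k * p ^ m * e ^ 2) := by
        rw [he, hu]
        ring

open MvPolynomial in
theorem totalDegree_map_of_injective {σ R S : Type*} [CommSemiring R] [CommSemiring S]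
    (p : MvPolynomial σ R) {f : R →+* S} (hf : Function.Injective f) :
    (map f p).totalDegree = p.totalDegree := by
  rw [totalDegree, totalDegree, support_map_of_injective _ hf]

/-- Leibniz bound for a determinant whose columns have bounded entries. -/
theorem abs_det_le_factorial_mul_prod {ι : Type*} [Fintype ι] [DecidableEq ι] (M : Matrix ι ι ℤ)
    (B : ι → ℤ) (h : ∀ i j, |M i j| ≤ B j) :
    |M.det| ≤ (Fintype.card ι).factorial * ∏ j, B j := by
  rw [Matrix.det_apply]
  refine (Finset.abs_sum_le_sum_abs _ _).trans ?_
  have : ∀ σ ∈ (Finset.univ : Finset (Equiv.Perm ι)),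
      |Equiv.Perm.sign σ • ∏ i, M (σ i) i| ≤ ∏ j, B j := by
    intro σ _
    rw [Units.smul_def, smul_eq_mul, abs_mul, Int.isUnit_iff_abs_eq.1 (Units.isUnit _), one_mul,
      Finset.abs_prod]
    exact Finset.prod_le_prod (fun _ _ => abs_nonneg _) fun i _ => h _ _
  refine (Finset.sum_le_card_nsmul _ _ _ this).trans (le_of_eq ?_)
  rw [Finset.card_univ, Fintype.card_perm, nsmul_eq_mul]

open MvPolynomial in
/-- The `p`-adic determinant method: the integral points of bounded height on a plane curve in a
residue class at which `∂G/∂y` does not vanish modulo `p` lie on another curve of small degree. -/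
theorem exists_not_dvd_vanishing_of_residue_class {G : MvPolynomial (Fin 2) ℤ} (hG : G ≠ 0)
    {p : ℕ} (hp : p.Prime) {N D : ℕ} {x₀ y₀ : ℤ} (hpy : ¬ (p : ℤ) ∣ eval ![x₀, y₀] (pderiv 1 G))
    (hsize : (D * G.totalDegree).factorial *
        N ^ (G.totalDegree * (G.totalDegree * D + ∑ i ∈ Finset.range D, i))
      < p ^ (∑ i ∈ Finset.range (D * G.totalDegree), i)) :
    ∃ H : MvPolynomial (Fin 2) ℚ, ¬ map (Int.castRingHom ℚ) G ∣ H ∧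
      H.totalDegree ≤ G.totalDegree + D ∧ ∀ x y : ℤ, 0 ≤ x → x ≤ N → 0 ≤ y → y ≤ N →
        (p : ℤ) ∣ x - x₀ → (p : ℤ) ∣ y - y₀ → eval ![x, y] G = 0 →
          eval ![(x : ℚ), (y : ℚ)] H = 0 := by
  have hinj : Function.Injective (Int.castRingHom ℚ) := Int.cast_injective
  have hG' : map (Int.castRingHom ℚ) G ≠ 0 := fun h =>
    hG (map_injective _ hinj (by rw [h, map_zero]))
  obtain ⟨a, b, hab, hnd⟩ := exists_layerExponent_not_dvd hG'
  rw [totalDegree_map_of_injective G hinj] at hab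
  obtain ⟨c, hc⟩ : ∃ c : ℤ, (p : ℤ) ∣ 1 - c * eval ![x₀, y₀] (pderiv 1 G) := by
    have hcop := ((Nat.prime_iff_prime_int.1 hp).coprime_iff_not_dvd).2 hpy
    obtain ⟨u, v, huv⟩ := hcop
    exact ⟨v, u, by linear_combination -huv⟩
  set E := ∑ i ∈ Finset.range (D * G.totalDegree), i with hE
  obtain ⟨f, hf⟩ := exists_polynomial_parametrization G hc E
  let ι := Fin D × (Fin a ⊕ Fin b)
  have hcard : Fintype.card ι = D * G.totalDegree := by simp [ι, hab]
  let α := {z : ℤ × ℤ // (0 ≤ z.1 ∧ z.1 ≤ N ∧ 0 ≤ z.2 ∧ z.2 ≤ N) ∧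
    (p : ℤ) ∣ z.1 - x₀ ∧ (p : ℤ) ∣ z.2 - y₀ ∧ eval ![z.1, z.2] G = 0}
  let w : α → ι → ℤ := fun z j => z.1.1 ^ layerExponent a b j 0 * z.1.2 ^ layerExponent a b j 1
  have hdet : ∀ P : ι → α, (Matrix.of fun i j => w (P i) j).det = 0 := by
    intro P
    have h1 : (p : ℤ) ^ E ∣ (Matrix.of fun i j => w (P i) j).det := by
      have hA := pow_dvd_det_polynomial_eval (p : ℤ) (fun i => (P i).1.1 - x₀)
        (fun i => (P i).2.2.1) (fun j : ι => (Polynomial.X + Polynomial.C x₀) ^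
          layerExponent a b j 0 * f ^ layerExponent a b j 1)
      rw [hcard] at hA
      have hB := dvd_det_sub_det ((p : ℤ) ^ E) (Matrix.of fun i j => w (P i) j)
        (Matrix.of fun i j => ((Polynomial.X + Polynomial.C x₀) ^
          layerExponent a b j 0 * f ^ layerExponent a b j 1).eval ((P i).1.1 - x₀)) ?_
      · simpa using dvd_add hB hA
      · intro i j
        have h := hf _ _ (P i).2.2.1 (P i).2.2.2.1 (P i).2.2.2.2
        have h' := (((pow_dvd_pow (p : ℤ) (Nat.le_succ E)).trans h).trans
          (sub_dvd_pow_sub_pow _ _ (layerExponent a b j 1))).mul_left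
            ((P i).1.1 ^ layerExponent a b j 0)
        simp only [w, Matrix.of_apply, Polynomial.eval_mul, Polynomial.eval_pow,
          Polynomial.eval_add, Polynomial.eval_X, Polynomial.eval_C, sub_add_cancel]
        rwa [← mul_sub]
    have h2 : |(Matrix.of fun i j => w (P i) j).det| ≤ ((D * G.totalDegree).factorial *
        N ^ (G.totalDegree * (G.totalDegree * D + ∑ i ∈ Finset.range D, i)) : ℕ) := by
      have := abs_det_le_factorial_mul_prod (Matrix.of fun i j => w (P i) j)
        (fun j => (N : ℤ) ^ (a + b + (j.1 : ℕ))) ?_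
      · refine this.trans (le_of_eq ?_)
        rw [hcard, Finset.prod_pow_eq_pow_sum]
        push_cast
        congr 2
        rw [Fintype.sum_prod_type, ← hab, Finset.sum_range]
        simp only [Finset.sum_const, Finset.card_univ, Fintype.card_sum, Fintype.card_fin,
          smul_eq_mul]
        rw [← Finset.mul_sum, Finset.sum_add_distrib]
        simp only [Finset.sum_const, Finset.card_univ, Fintype.card_fin, smul_eq_mul]
        ring
      · intro i j
        obtain ⟨hx0, hx1, hy0, hy1⟩ := (P i).2.1
        rw [← layerExponent_add, pow_add]
        simp only [w, Matrix.of_apply, abs_mul, abs_pow, abs_of_nonneg hx0, abs_of_nonneg hy0]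
        gcongr
    have h3 : ((D * G.totalDegree).factorial *
        N ^ (G.totalDegree * (G.totalDegree * D + ∑ i ∈ Finset.range D, i)) : ℕ) <
          (p : ℤ) ^ E := by exact_mod_cast hsize
    exact Int.eq_zero_of_abs_lt_dvd h1 (h2.trans_lt h3)
  obtain ⟨k, hk0, hk⟩ := exists_ne_zero_of_forall_det_eq_zero (K := ℚ) (fun z j => (w z j : ℚ))
    (fun P => by
      have := congrArg (Int.castRingHom ℚ) (hdet P)
      rw [RingHom.map_det, map_zero] at this
      exact this)
  refine ⟨∑ q, monomial (layerExponent a b q) (k q), hnd D k hk0, ?_, ?_⟩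
  · refine totalDegree_finsetSum_le fun q _ => ?_
    refine (totalDegree_monomial_le _ _).trans ?_
    refine (finTwo_finsupp_sum _).le.trans ?_
    rw [layerExponent_add]
    omega
  · intro x y hx0 hx1 hy0 hy1 hxp hyp hxy
    have := hk ⟨(x, y), ⟨hx0, hx1, hy0, hy1⟩, hxp, hyp, hxy⟩
    rw [map_sum, ← this]
    refine Finset.sum_congr rfl fun q _ => ?_
    rw [eval_monomial, Finsupp.prod_fintype _ _ (fun _ => pow_zero _), Fin.prod_univ_two]
    simp [w]

attribute [local instance] Matrix.seminormedAddCommGroup in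
/-- Siegel's lemma for an arbitrary family of bounded integral linear forms: if the forms have a
nontrivial common zero, then they have a nontrivial integral common zero of small height. -/
theorem exists_small_common_zero {ι α : Type*} [Fintype ι] (v : α → ι → ℤ) (B : ℕ) (hB : 1 ≤ B)
    (hv : ∀ x j, |v x j| ≤ B) (c : ι → ℚ) (hc : c ≠ 0) (hcv : ∀ x, ∑ j, c j * v x j = 0) :
    ∃ t : ι → ℤ, t ≠ 0 ∧ (∀ x, ∑ j, t j * v x j = 0) ∧
      ∀ j, |t j| ≤ (Fintype.card ι * B : ℕ) ^ Fintype.card ι := by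
  classical
  let u : α → ι → ℚ := fun x j => v x j
  let φ : (ι → ℚ) → (ι → ℚ) →ₗ[ℚ] ℚ := fun w => ∑ j, w j • LinearMap.proj j
  have hφ : ∀ w z, φ w z = ∑ j, w j * z j := fun w z => by simp [φ]
  obtain ⟨κ, a, -, hspan, hli⟩ := exists_linearIndependent' ℚ u
  have hfin : Finite κ := hli.finite
  have := Fintype.ofFinite κ
  obtain ⟨j₀, hj₀⟩ := Function.ne_iff.1 hc
  have hcard : Fintype.card κ < Fintype.card ι := by
    by_contra! hle
    have hle' := hli.fintype_card_le_finrank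
    rw [Module.finrank_pi] at hle'
    have htop := hli.span_eq_top_of_card_eq_finrank' (by rw [Module.finrank_pi]; omega)
    have hker : (⊤ : Submodule ℚ (ι → ℚ)) ≤ LinearMap.ker (φ c) := by
      rw [← htop, Submodule.span_le]
      rintro _ ⟨k, rfl⟩
      exact LinearMap.mem_ker.2 ((hφ _ _).trans (hcv (a k)))
    have h0 := LinearMap.mem_ker.1 (hker (Submodule.mem_top (x := Pi.single j₀ 1)))
    rw [hφ] at h0
    simp [Pi.single_apply] at h0
    exact hj₀ h0
  have hι : 1 ≤ Fintype.card ι := by omega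
  have key : ∃ t : ι → ℤ, t ≠ 0 ∧ (∀ k, ∑ j, t j * v (a k) j = 0) ∧
      ∀ j, |t j| ≤ (Fintype.card ι * B : ℕ) ^ Fintype.card ι := by
    rcases Nat.eq_zero_or_pos (Fintype.card κ) with h0 | hpos
    · have := Fintype.card_eq_zero_iff.1 h0
      refine ⟨Pi.single j₀ 1, by simp, fun k => isEmptyElim k, fun j => ?_⟩
      have h1 : (1 : ℤ) ≤ ((Fintype.card ι * B : ℕ) : ℤ) ^ Fintype.card ι :=
        one_le_pow₀ (by exact_mod_cast Nat.mul_pos hι hB)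
      by_cases hj : j = j₀
      · subst hj
        simpa using h1
      · simp only [Pi.single_apply, hj, if_false, abs_zero]
        omega
    · let A : Matrix κ ι ℤ := Matrix.of fun k j => v (a k) j
      obtain ⟨t, ht0, htA, htn⟩ := Int.Matrix.exists_ne_zero_int_vec_norm_le A hcard hpos
      refine ⟨t, ht0, fun k => ?_, fun j => ?_⟩
      · have := congrFun htA k
        simp only [Matrix.mulVec, dotProduct, A, Matrix.of_apply, Pi.zero_apply] at this
        rw [← this]
        exact Finset.sum_congr rfl fun j _ => mul_comm _ _
      · have hA : ‖A‖ ≤ B := by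
          refine (Matrix.norm_le_iff (by positivity)).2 fun k j => ?_
          rw [Int.norm_eq_abs]
          exact_mod_cast hv (a k) j
        have h1 : (1 : ℝ) ≤ (Fintype.card ι : ℝ) * max 1 ‖A‖ := by
          have : (1 : ℝ) ≤ Fintype.card ι := by exact_mod_cast hι
          nlinarith [le_max_left (1 : ℝ) ‖A‖]
        have h2 : (Fintype.card κ : ℝ) / (Fintype.card ι - Fintype.card κ) ≤ Fintype.card ι := by
          have hc' : (Fintype.card κ : ℝ) + 1 ≤ Fintype.card ι := by exact_mod_cast hcard
          refine (div_le_self (by positivity) (by linarith)).trans (by linarith)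
        have h3 : ‖t j‖ ≤ ((Fintype.card ι * B : ℕ) : ℝ) ^ Fintype.card ι := by
          refine (norm_le_pi_norm t j).trans (htn.trans ?_)
          refine (Real.rpow_le_rpow_of_exponent_le h1 h2).trans ?_
          rw [Real.rpow_natCast]
          push_cast
          gcongr
          exact max_le (by exact_mod_cast hB) hA
        rw [Int.norm_eq_abs] at h3
        exact_mod_cast h3
  obtain ⟨t, ht0, htk, htb⟩ := key
  refine ⟨t, ht0, fun x => ?_, htb⟩
  have hker : Submodule.span ℚ (Set.range u) ≤ LinearMap.ker (φ fun j => (t j : ℚ)) := by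
    rw [← hspan, Submodule.span_le]
    rintro _ ⟨k, rfl⟩
    refine LinearMap.mem_ker.2 ((hφ _ _).trans ?_)
    change ∑ j, (t j : ℚ) * (v (a k) j : ℚ) = 0
    exact_mod_cast htk k
  have h0 := LinearMap.mem_ker.1 (hker (Submodule.subset_span ⟨x, rfl⟩))
  rw [hφ] at h0
  change ∑ j, (t j : ℚ) * (v x j : ℚ) = 0 at h0
  exact_mod_cast h0

/-- The exponents of the bivariate monomials of total degree at most `d`. -/
noncomputable def boundedExponent {d : ℕ}
    (q : {q : Fin (d + 1) × Fin (d + 1) // (q.1 : ℕ) + q.2 ≤ d}) : Fin 2 →₀ ℕ :=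
  Finsupp.equivFunOnFinite.symm ![q.1.1, q.1.2]

theorem boundedExponent_injective (d : ℕ) :
    Function.Injective (boundedExponent (d := d)) := by
  rintro ⟨⟨i, j⟩, h⟩ ⟨⟨i', j'⟩, h'⟩ hq
  have h0 := DFunLike.congr_fun hq 0
  have h1 := DFunLike.congr_fun hq 1
  simp only [boundedExponent, Finsupp.equivFunOnFinite_symm_apply_apply] at h0 h1
  simp at h0 h1
  simp [Fin.ext_iff, h0, h1]

theorem exists_boundedExponent_eq {d : ℕ} {n : Fin 2 →₀ ℕ} (hn : n 0 + n 1 ≤ d) :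
    ∃ q, boundedExponent (d := d) q = n := by
  refine ⟨⟨(⟨n 0, by omega⟩, ⟨n 1, by omega⟩), hn⟩, ?_⟩
  ext i
  fin_cases i <;> simp [boundedExponent]

open MvPolynomial in
/-- The integral points of bounded height on a plane curve lie on a curve of no larger degree
which is defined by an equation with small coefficients. -/
theorem exists_small_equation {G : MvPolynomial (Fin 2) ℤ} (hG : G ≠ 0) {d N : ℕ}
    (hd : G.totalDegree = d) (hN : 1 ≤ N) :
    ∃ H : MvPolynomial (Fin 2) ℤ, H ≠ 0 ∧ H.totalDegree ≤ d ∧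
      ∀ x y : ℤ, 0 ≤ x → x ≤ N → 0 ≤ y → y ≤ N → eval ![x, y] G = 0 → eval ![x, y] H = 0 ∧
        |eval ![x, y] (pderiv 1 H)| ≤
          ((d + 1) ^ 2 * (d * N ^ d * ((d + 1) ^ 2 * N ^ d) ^ ((d + 1) ^ 2)) : ℕ) := by
  classical
  let ι := {q : Fin (d + 1) × Fin (d + 1) // (q.1 : ℕ) + q.2 ≤ d}
  have hcard : Fintype.card ι ≤ (d + 1) ^ 2 :=
    (Fintype.card_subtype_le _).trans (by simp [sq])
  let α := {z : ℤ × ℤ // (0 ≤ z.1 ∧ z.1 ≤ N ∧ 0 ≤ z.2 ∧ z.2 ≤ N) ∧ eval ![z.1, z.2] G = 0}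
  let v : α → ι → ℤ := fun z q => z.1.1 ^ (q.1.1 : ℕ) * z.1.2 ^ (q.1.2 : ℕ)
  have hpow : ∀ (x y : ℤ) (i j : ℕ), 0 ≤ x → x ≤ N → 0 ≤ y → y ≤ N → i + j ≤ d →
      |x ^ i * y ^ j| ≤ (N ^ d : ℕ) := by
    intro x y i j hx0 hx1 hy0 hy1 hij
    rw [abs_mul, abs_pow, abs_pow, abs_of_nonneg hx0, abs_of_nonneg hy0]
    calc x ^ i * y ^ j ≤ (N : ℤ) ^ i * (N : ℤ) ^ j := by gcongr
      _ = (N : ℤ) ^ (i + j) := (pow_add _ _ _).symm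
      _ ≤ (N : ℤ) ^ d := pow_le_pow_right₀ (by exact_mod_cast hN) hij
      _ = (N ^ d : ℕ) := by push_cast; rfl
  have hmon : ∀ (x y : ℤ) (q : ι) (r : ℤ), eval ![x, y] (monomial (boundedExponent q) r)
      = r * (x ^ (q.1.1 : ℕ) * y ^ (q.1.2 : ℕ)) := by
    intro x y q r
    rw [eval_monomial, Finsupp.prod_fintype _ _ (fun _ => pow_zero _), Fin.prod_univ_two]
    simp [boundedExponent]
  have hdeg : ∀ n ∈ G.support, n 0 + n 1 ≤ d := by
    intro n hn
    rw [← finTwo_finsupp_sum, ← hd]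
    exact le_totalDegree hn
  have hsum : G = ∑ q : ι, monomial (boundedExponent q) (coeff (boundedExponent q) G) := by
    conv_lhs => rw [G.as_sum]
    rw [← Finset.sum_image (s := Finset.univ) (g := boundedExponent)
      (f := fun n => monomial n (coeff n G)) (fun q _ q' _ h => boundedExponent_injective d h)]
    refine Finset.sum_subset (fun n hn => ?_) (fun n _ hn => ?_)
    · obtain ⟨q, hq⟩ := exists_boundedExponent_eq (hdeg n hn)
      exact Finset.mem_image.2 ⟨q, Finset.mem_univ _, hq⟩
    · rw [notMem_support_iff.1 hn, monomial_zero]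
  obtain ⟨t, ht0, htv, htb⟩ := exists_small_common_zero v (N ^ d) (Nat.one_le_pow _ _ hN)
    (fun z q => hpow _ _ _ _ z.2.1.1 z.2.1.2.1 z.2.1.2.2.1 z.2.1.2.2.2 q.2)
    (fun q => ((coeff (boundedExponent q) G : ℤ) : ℚ))
    (fun h0 => hG (by
      rw [hsum]
      refine Finset.sum_eq_zero fun q _ => ?_
      have : ((coeff (boundedExponent q) G : ℤ) : ℚ) = 0 := congrFun h0 q
      rw [show coeff (boundedExponent q) G = 0 by exact_mod_cast this, monomial_zero]))
    (fun z => by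
      have := (congrArg (eval ![z.1.1, z.1.2]) hsum).symm.trans z.2.2
      rw [map_sum] at this
      simp only [hmon] at this
      exact_mod_cast this)
  have hcoeff : ∀ q, coeff (boundedExponent q)
      (∑ q : ι, monomial (boundedExponent q) (t q)) = t q := by
    intro q
    rw [coeff_sum, Finset.sum_eq_single q]
    · simp
    · intro r _ hr
      rw [coeff_monomial, if_neg fun h => hr (boundedExponent_injective d h)]
    · simp
  refine ⟨∑ q : ι, monomial (boundedExponent q) (t q), ?_, ?_, ?_⟩
  · intro h0
    apply ht0
    funext q
    rw [← hcoeff q, h0]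
    simp
  · refine totalDegree_finsetSum_le fun q _ => (totalDegree_monomial_le _ _).trans ?_
    refine (finTwo_finsupp_sum _).le.trans ?_
    simpa [boundedExponent] using q.2
  · intro x y hx0 hx1 hy0 hy1 hxy
    constructor
    · rw [map_sum]
      simp only [hmon]
      exact htv ⟨(x, y), ⟨hx0, hx1, hy0, hy1⟩, hxy⟩
    · rw [map_sum, map_sum]
      refine (Finset.abs_sum_le_sum_abs _ _).trans ?_
      have hterm : ∀ q ∈ (Finset.univ : Finset ι),
          |eval ![x, y] (pderiv 1 (monomial (boundedExponent q) (t q)))| ≤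
            ((d * N ^ d * ((d + 1) ^ 2 * N ^ d) ^ ((d + 1) ^ 2) : ℕ) : ℤ) := by
        intro q _
        rw [pderiv_monomial, eval_monomial, Finsupp.prod_fintype _ _ (fun _ => pow_zero _),
          Fin.prod_univ_two, abs_mul, abs_mul]
        have h1 := hpow x y (q.1.1 : ℕ) ((q.1.2 : ℕ) - 1) hx0 hx1 hy0 hy1 (by have := q.2; omega)
        have h2 : |t q| ≤ ((((d + 1) ^ 2 * N ^ d) ^ ((d + 1) ^ 2) : ℕ) : ℤ) := by
          refine (htb q).trans ?_
          have h3 : (Fintype.card ι * N ^ d) ^ Fintype.card ι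
              ≤ ((d + 1) ^ 2 * N ^ d) ^ ((d + 1) ^ 2) := by
            refine (Nat.pow_le_pow_left (Nat.mul_le_mul_right _ hcard) _).trans ?_
            exact Nat.pow_le_pow_right (Nat.mul_pos (by positivity) (by positivity)) hcard
          exact_mod_cast h3
        have h4 : |((boundedExponent q 1 : ℕ) : ℤ)| ≤ d := by
          rw [Nat.abs_cast]
          simp only [boundedExponent]
          have := q.2
          simp
          omega
        have h5 : |![x, y] 0 ^ (boundedExponent q - Finsupp.single 1 1 : Fin 2 →₀ ℕ) 0 *
            ![x, y] 1 ^ (boundedExponent q - Finsupp.single 1 1 : Fin 2 →₀ ℕ) 1| ≤ ((N ^ d : ℕ) : ℤ) := by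
          simpa [boundedExponent] using h1
        calc _ ≤ ((((d + 1) ^ 2 * N ^ d) ^ ((d + 1) ^ 2) : ℕ) : ℤ) * d * ((N ^ d : ℕ) : ℤ) := by
              gcongr
          _ = _ := by push_cast; ring
      refine (Finset.sum_le_card_nsmul _ _ _ hterm).trans ?_
      rw [Finset.card_univ, nsmul_eq_mul]
      have : Fintype.card ι * (d * N ^ d * ((d + 1) ^ 2 * N ^ d) ^ ((d + 1) ^ 2))
        ≤ (d + 1) ^ 2 * (d * N ^ d * ((d + 1) ^ 2 * N ^ d) ^ ((d + 1) ^ 2)) := by gcongr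
      exact_mod_cast this

open MvPolynomial in
theorem irreducible_of_map {σ K L : Type*} [Field K] [Field L] (f : K →+* L)
    {p : MvPolynomial σ K} (hp : Irreducible (map f p)) : Irreducible p := by
  have : IsLocalHom (map (σ := σ) f) := by
    refine ⟨fun q hq => ?_⟩
    rw [isUnit_iff_totalDegree_of_isReduced, totalDegree_map_of_injective q f.injective,
      coeff_map, isUnit_iff_ne_zero, map_ne_zero] at hq
    rw [isUnit_iff_totalDegree_of_isReduced, isUnit_iff_ne_zero]
    exact hq
  exact Irreducible.of_map hp

open MvPolynomial in
theorem eval_map_finTwo {R S : Type*} [CommRing R] [CommRing S] (f : R →+* S) (x y : R)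
    (G : MvPolynomial (Fin 2) R) : eval ![f x, f y] (map f G) = f (eval ![x, y] G) := by
  rw [eval_map, eval₂_comp f ![x, y] G]
  congr 1
  funext i
  fin_cases i <;> rfl

open MvPolynomial in
theorem totalDegree_pderiv_le {σ R : Type*} [CommSemiring R] (i : σ) (G : MvPolynomial σ R) :
    (pderiv i G).totalDegree ≤ G.totalDegree - 1 := by
  conv_lhs => rw [G.as_sum, map_sum]
  refine totalDegree_finsetSum_le fun n hn => ?_
  rw [pderiv_monomial]
  by_cases hi : n i = 0
  · simp [hi]
  · refine (totalDegree_monomial_le _ _).trans ?_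
    have h1 := le_totalDegree hn
    have h2 : n = n - Finsupp.single i 1 + Finsupp.single i 1 :=
      (tsub_add_cancel_of_le (by simpa using Nat.one_le_iff_ne_zero.2 hi)).symm
    rw [h2, Finsupp.sum_add_index' (fun _ => rfl) (fun _ _ _ => rfl)] at h1
    simp only [Finsupp.sum_single_index] at h1
    change Finsupp.sum _ (fun _ e => e) ≤ _
    omega

open MvPolynomial in
theorem natDegree_verticalSlice_le {R : Type*} [CommRing R] (x : R)
    (G : MvPolynomial (Fin 2) R) : (verticalSlice x G).natDegree ≤ G.totalDegree := by
  refine (aeval_natDegree_le G le_rfl _ (n := 1) fun i => ?_).trans_eq (mul_one _)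
  fin_cases i <;> simp [Polynomial.natDegree_X_le]

open MvPolynomial in
/-- Bézout's inequality for the integral points on an irreducible curve. -/
theorem card_integral_common_zeros_le {G : MvPolynomial (Fin 2) ℤ}
    (hG : Irreducible (map (Int.castRingHom ℚ) G)) {H : MvPolynomial (Fin 2) ℚ}
    (hGH : ¬ map (Int.castRingHom ℚ) G ∣ H) (S : Finset (ℤ × ℤ))
    (hS : ∀ P ∈ S, eval ![P.1, P.2] G = 0 ∧ eval ![(P.1 : ℚ), (P.2 : ℚ)] H = 0) :
    S.card ≤ G.totalDegree * H.totalDegree := by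
  classical
  let φ : ℤ × ℤ → Fin 2 → ℚ := fun P => ![(P.1 : ℚ), (P.2 : ℚ)]
  have hφ : Function.Injective φ := by
    rintro ⟨x, y⟩ ⟨x', y'⟩ h
    have h0 := congrFun h 0
    have h1 := congrFun h 1
    simp only [φ] at h0 h1
    simp at h0 h1
    simp [h0, h1]
  rw [← Finset.card_image_of_injective S hφ,
    ← totalDegree_map_of_injective G (f := Int.castRingHom ℚ) Int.cast_injective]
  refine card_common_zeros_le hG hGH _ fun P hP => ?_
  obtain ⟨P, hPS, rfl⟩ := Finset.mem_image.1 hP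
  refine ⟨?_, (hS P hPS).2⟩
  have := eval_map_finTwo (Int.castRingHom ℚ) P.1 P.2 G
  rw [(hS P hPS).1, map_zero] at this
  exact this

open MvPolynomial in
/-- Integral points at which the vertical partial derivative does not vanish modulo a
sufficiently large prime `p`. -/
theorem card_zeros_le_of_prime {G : MvPolynomial (Fin 2) ℤ}
    (hG : Irreducible (map (Int.castRingHom ℚ) G)) {p : ℕ} (hp : p.Prime) {N D : ℕ}
    (hsize : (D * G.totalDegree).factorial *
        N ^ (G.totalDegree * (G.totalDegree * D + ∑ i ∈ Finset.range D, i))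
      < p ^ (∑ i ∈ Finset.range (D * G.totalDegree), i))
    (S : Finset (ℤ × ℤ)) (hbox : ∀ P ∈ S, 0 ≤ P.1 ∧ P.1 ≤ N ∧ 0 ≤ P.2 ∧ P.2 ≤ N)
    (hS : ∀ P ∈ S, eval ![P.1, P.2] G = 0)
    (hSp : ∀ P ∈ S, ¬ (p : ℤ) ∣ eval ![P.1, P.2] (pderiv 1 G)) :
    S.card ≤ G.totalDegree * (G.totalDegree + D) * (G.totalDegree * p) := by
  classical
  have := Fact.mk hp
  have hG0 : G ≠ 0 := by
    rintro rfl
    exact hG.ne_zero (map_zero _)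
  let φ : ℤ × ℤ → ZMod p × ZMod p := fun P => (P.1, P.2)
  have hfib : ∀ b ∈ S.image φ, (S.filter fun P => φ P = b).card
      ≤ G.totalDegree * (G.totalDegree + D) := by
    intro b hb
    obtain ⟨P, hP, rfl⟩ := Finset.mem_image.1 hb
    obtain ⟨H, hGH, hdeg, hH⟩ := exists_not_dvd_vanishing_of_residue_class hG0 hp (hSp P hP) hsize
    refine (card_integral_common_zeros_le hG hGH _ fun Q hQ => ?_).trans
      (Nat.mul_le_mul_left _ hdeg)
    obtain ⟨hQS, hQP⟩ := Finset.mem_filter.1 hQ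
    obtain ⟨hx0, hx1, hy0, hy1⟩ := hbox Q hQS
    have h1 : ((Q.1 : ℤ) : ZMod p) = (P.1 : ℤ) := congrArg Prod.fst hQP
    have h2 : ((Q.2 : ℤ) : ZMod p) = (P.2 : ℤ) := congrArg Prod.snd hQP
    refine ⟨hS Q hQS, hH _ _ hx0 hx1 hy0 hy1 ?_ ?_ (hS Q hQS)⟩
    · exact (ZMod.intCast_eq_intCast_iff_dvd_sub _ _ _).1 h1.symm
    · exact (ZMod.intCast_eq_intCast_iff_dvd_sub _ _ _).1 h2.symm
  refine (Finset.card_le_mul_card_image S _ hfib).trans (Nat.mul_le_mul_left _ ?_)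
  refine (Finset.card_le_mul_card_image_of_maps_to (t := Finset.univ) (f := Prod.fst)
    (fun _ _ => Finset.mem_univ _) G.totalDegree fun a _ => ?_).trans_eq (by
      rw [Finset.card_univ, ZMod.card])
  let f : Polynomial (ZMod p) := verticalSlice a (map (Int.castRingHom (ZMod p)) G)
  have hdegf : f.natDegree ≤ G.totalDegree :=
    (natDegree_verticalSlice_le _ _).trans (Finset.sup_mono (support_map_subset _ _))
  have hroot : ∀ b ∈ (S.image φ).filter (fun b => b.1 = a), f ≠ 0 ∧ f.IsRoot b.2 := by
    intro b hb
    obtain ⟨hb, hba⟩ := Finset.mem_filter.1 hb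
    obtain ⟨P, hP, rfl⟩ := Finset.mem_image.1 hb
    have ha : a = Int.castRingHom (ZMod p) P.1 := hba.symm
    constructor
    · intro hf0
      apply hSp P hP
      rw [← ZMod.intCast_zmod_eq_zero_iff_dvd]
      have h := eval_map_finTwo (Int.castRingHom (ZMod p)) P.1 P.2 (pderiv 1 G)
      rw [← pderiv_map, ← eval_verticalSlice, ← derivative_verticalSlice, ← ha] at h
      change Polynomial.eval _ (Polynomial.derivative f) = _ at h
      rw [hf0, Polynomial.derivative_zero, Polynomial.eval_zero] at h
      exact h.symm
    · have h := eval_map_finTwo (Int.castRingHom (ZMod p)) P.1 P.2 G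
      rw [← eval_verticalSlice, ← ha, hS P hP, map_zero] at h
      exact h
  have hinj : Set.InjOn Prod.snd (((S.image φ).filter fun b => b.1 = a : Finset _) :
      Set (ZMod p × ZMod p)) := by
    intro b hb c hc h
    have hb' := (Finset.mem_filter.1 hb).2
    have hc' := (Finset.mem_filter.1 hc).2
    exact Prod.ext (hb'.trans hc'.symm) h
  rw [← Finset.card_image_of_injOn hinj]
  refine (Finset.card_le_card fun y hy => ?_).trans
    (f.roots.toFinset_card_le.trans (f.card_roots'.trans hdegf))
  obtain ⟨b, hb, rfl⟩ := Finset.mem_image.1 hy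
  rw [Multiset.mem_toFinset, Polynomial.mem_roots (hroot b hb).1]
  exact (hroot b hb).2

open MvPolynomial in
theorem pderiv_ne_zero_of_zero {G : MvPolynomial (Fin 2) ℤ}
    (hG : Irreducible (map (Int.castRingHom ℚ) G)) (hd : 2 ≤ G.totalDegree) {x₀ y₀ : ℤ}
    (h : eval ![x₀, y₀] G = 0) : pderiv 1 G ≠ 0 := by
  intro h0
  have hder := derivative_verticalSlice x₀ G
  rw [h0, map_zero] at hder
  have hall : ∀ y : ℤ, eval ![x₀, y] G = 0 := by
    intro y
    have hC := Polynomial.eq_C_of_derivative_eq_zero hder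
    rw [← eval_verticalSlice] at h ⊢
    rw [hC, Polynomial.eval_C] at h ⊢
    exact h
  have hdeg : (X 0 - C (x₀ : ℚ) : MvPolynomial (Fin 2) ℚ).totalDegree ≤ 1 := by
    refine (totalDegree_sub _ _).trans ?_
    rw [totalDegree_X, totalDegree_C]
    simp
  have hndvd : ¬ map (Int.castRingHom ℚ) G ∣ (X 0 - C (x₀ : ℚ)) := by
    intro hdvd
    have hne : (X 0 - C (x₀ : ℚ) : MvPolynomial (Fin 2) ℚ) ≠ 0 := by
      intro h0
      have := congrArg (eval ![(x₀ : ℚ) + 1, 0]) h0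
      simp at this
    have := totalDegree_le_of_dvd_of_isDomain hdvd hne
    rw [totalDegree_map_of_injective G (f := Int.castRingHom ℚ) Int.cast_injective] at this
    omega
  have hinj : Function.Injective fun n : ℕ => (x₀, (n : ℤ)) := fun a b hab => by simpa using hab
  have := card_integral_common_zeros_le hG hndvd
    ((Finset.range (G.totalDegree + 1)).map ⟨fun n : ℕ => (x₀, (n : ℤ)), hinj⟩) (by
      intro P hP
      obtain ⟨n, -, rfl⟩ := Finset.mem_map.1 hP
      exact ⟨hall _, by simp⟩)
  rw [Finset.card_map, Finset.card_range] at this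
  nlinarith

open MvPolynomial in
/-- The number of integral points of bounded height on an irreducible curve whose equation has
small derivatives at these points. -/
theorem card_zeros_le_of_derivative_lt {G : MvPolynomial (Fin 2) ℤ}
    (hG : Irreducible (map (Int.castRingHom ℚ) G)) (hd : 2 ≤ G.totalDegree) {N D P₀ Q : ℕ}
    (hsize : (D * G.totalDegree).factorial *
        N ^ (G.totalDegree * (G.totalDegree * D + ∑ i ∈ Finset.range D, i))
      < P₀ ^ (∑ i ∈ Finset.range (D * G.totalDegree), i))
    (T : Finset ℕ) (hT : ∀ p ∈ T, p.Prime ∧ P₀ ≤ p ∧ p ≤ Q) (S : Finset (ℤ × ℤ))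
    (hbox : ∀ P ∈ S, 0 ≤ P.1 ∧ P.1 ≤ N ∧ 0 ≤ P.2 ∧ P.2 ≤ N)
    (hS : ∀ P ∈ S, eval ![P.1, P.2] G = 0)
    (hder : ∀ P ∈ S, |eval ![P.1, P.2] (pderiv 1 G)| < (P₀ : ℤ) ^ T.card) :
    S.card ≤ G.totalDegree * G.totalDegree +
      T.card * (G.totalDegree * (G.totalDegree + D) * (G.totalDegree * Q)) := by
  classical
  let S₀ := S.filter fun P => eval ![P.1, P.2] (pderiv 1 G) = 0
  let S₁ := fun p : ℕ => S.filter fun P => ¬ (p : ℤ) ∣ eval ![P.1, P.2] (pderiv 1 G)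
  have hcover : S ⊆ S₀ ∪ T.biUnion S₁ := by
    intro P hP
    by_cases h0 : eval ![P.1, P.2] (pderiv 1 G) = 0
    · exact Finset.mem_union_left _ (Finset.mem_filter.2 ⟨hP, h0⟩)
    refine Finset.mem_union_right _ (Finset.mem_biUnion.2 ?_)
    by_contra! hall
    have hdvd : ∀ p ∈ T, (p : ℤ) ∣ eval ![P.1, P.2] (pderiv 1 G) := by
      intro p hp
      by_contra hnd
      exact hall p hp (Finset.mem_filter.2 ⟨hP, hnd⟩)
    have hprod : ((∏ p ∈ T, p : ℕ) : ℤ) ∣ eval ![P.1, P.2] (pderiv 1 G) := by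
      rw [Int.natCast_dvd]
      exact Finset.prod_primes_dvd _ (fun p hp => (hT p hp).1.prime)
        fun p hp => Int.natCast_dvd.1 (hdvd p hp)
    have hle : (P₀ : ℤ) ^ T.card ≤ ((∏ p ∈ T, p : ℕ) : ℤ) := by
      exact_mod_cast Finset.pow_card_le_prod _ _ _ fun p hp => (hT p hp).2.1
    exact h0 (Int.eq_zero_of_abs_lt_dvd hprod ((hder P hP).trans_le hle))
  refine (Finset.card_le_card hcover).trans ((Finset.card_union_le _ _).trans ?_)
  refine Nat.add_le_add ?_ (Finset.card_biUnion_le_card_mul _ _ _ fun p hp => ?_)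
  · rcases S₀.eq_empty_or_nonempty with hS₀ | ⟨P, hP⟩
    · simp [hS₀]
    have hne := pderiv_ne_zero_of_zero hG hd (hS P (Finset.mem_filter.1 hP).1)
    have hndvd : ¬ map (Int.castRingHom ℚ) G ∣ map (Int.castRingHom ℚ) (pderiv 1 G) := by
      intro hdvd
      have := totalDegree_le_of_dvd_of_isDomain hdvd fun h =>
        hne (map_injective _ (Int.cast_injective (α := ℚ)) (by rw [h, map_zero]))
      rw [totalDegree_map_of_injective G (f := Int.castRingHom ℚ) Int.cast_injective] at this
      have h1 := totalDegree_pderiv_le (1 : Fin 2) G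
      have h2 := totalDegree_map_of_injective (pderiv 1 G) (f := Int.castRingHom ℚ)
        Int.cast_injective
      omega
    refine (card_integral_common_zeros_le hG hndvd _ fun P hP => ?_).trans
      (Nat.mul_le_mul_left _ ?_)
    · obtain ⟨hPS, hP0⟩ := Finset.mem_filter.1 hP
      refine ⟨hS P hPS, ?_⟩
      have := eval_map_finTwo (Int.castRingHom ℚ) P.1 P.2 (pderiv 1 G)
      rw [hP0, map_zero] at this
      exact this
    · rw [totalDegree_map_of_injective _ (f := Int.castRingHom ℚ) Int.cast_injective]
      exact (totalDegree_pderiv_le _ _).trans (Nat.sub_le _ _)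
  · obtain ⟨hp, hPp, hpQ⟩ := hT p hp
    refine (card_zeros_le_of_prime hG hp (N := N) (D := D)
      (hsize.trans_le (Nat.pow_le_pow_left hPp _)) (S₁ p)
      (fun P hP => hbox P (Finset.mem_filter.1 hP).1)
      (fun P hP => hS P (Finset.mem_filter.1 hP).1)
      (fun P hP => (Finset.mem_filter.1 hP).2)).trans ?_
    gcongr

open MvPolynomial in
/-- The number of integral points of bounded height on an irreducible curve, in terms of an
auxiliary set of primes. -/
theorem card_zeros_le {G : MvPolynomial (Fin 2) ℤ}
    (hG : Irreducible (map (Int.castRingHom ℚ) G)) {d : ℕ} (hd : G.totalDegree = d) (hd2 : 2 ≤ d)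
    {N D P₀ Q : ℕ} (hN : 1 ≤ N)
    (hsize : (D * d).factorial * N ^ (d * (d * D + ∑ i ∈ Finset.range D, i))
      < P₀ ^ (∑ i ∈ Finset.range (D * d), i))
    (T : Finset ℕ) (hT : ∀ p ∈ T, p.Prime ∧ P₀ ≤ p ∧ p ≤ Q)
    (hder : (d + 1) ^ 2 * (d * N ^ d * ((d + 1) ^ 2 * N ^ d) ^ ((d + 1) ^ 2)) < P₀ ^ T.card)
    (S : Finset (ℤ × ℤ)) (hbox : ∀ P ∈ S, 0 ≤ P.1 ∧ P.1 ≤ N ∧ 0 ≤ P.2 ∧ P.2 ≤ N)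
    (hS : ∀ P ∈ S, eval ![P.1, P.2] G = 0) :
    S.card ≤ d * d + T.card * (d * (d + D) * (d * Q)) := by
  have hinj : Function.Injective (Int.castRingHom ℚ) := Int.cast_injective
  have hG0 : G ≠ 0 := by
    rintro rfl
    exact hG.ne_zero (map_zero _)
  obtain ⟨H, hH0, hHd, hH⟩ := exists_small_equation hG0 hd hN
  have hHS : ∀ P ∈ S, eval ![P.1, P.2] H = 0 ∧
      |eval ![P.1, P.2] (pderiv 1 H)| < (P₀ : ℤ) ^ T.card := by
    intro P hP
    obtain ⟨hx0, hx1, hy0, hy1⟩ := hbox P hP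
    obtain ⟨h1, h2⟩ := hH _ _ hx0 hx1 hy0 hy1 (hS P hP)
    exact ⟨h1, h2.trans_lt (by exact_mod_cast hder)⟩
  by_cases hGH : map (Int.castRingHom ℚ) G ∣ map (Int.castRingHom ℚ) H
  · have hH' : map (Int.castRingHom ℚ) H ≠ 0 := fun h =>
      hH0 (map_injective _ hinj (by rw [h, map_zero]))
    obtain ⟨C, hC⟩ := hGH
    have hmul := hC ▸ hH'
    have hdeg := congrArg totalDegree hC
    rw [totalDegree_mul_of_isDomain (left_ne_zero_of_mul hmul) (right_ne_zero_of_mul hmul),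
      totalDegree_map_of_injective _ hinj, totalDegree_map_of_injective _ hinj, hd] at hdeg
    have hHd' : H.totalDegree = d := by omega
    have hCu : IsUnit C := by
      have hC0 : C.totalDegree = 0 := by omega
      rw [totalDegree_eq_zero_iff_eq_C] at hC0
      have hne := right_ne_zero_of_mul hmul
      rw [hC0] at hne ⊢
      exact (isUnit_iff_ne_zero.2 fun h => hne (by rw [h, map_zero])).map MvPolynomial.C
    have hHirr : Irreducible (map (Int.castRingHom ℚ) H) := by
      rw [hC]
      exact (irreducible_mul_isUnit hCu).2 hG
    have := card_zeros_le_of_derivative_lt hHirr (hHd'.symm ▸ hd2) (N := N) (D := D) (P₀ := P₀)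
      (Q := Q) (by rwa [hHd']) T hT S hbox (fun P hP => (hHS P hP).1) (fun P hP => (hHS P hP).2)
    rwa [hHd'] at this
  · have := card_integral_common_zeros_le hG hGH S fun P hP => ⟨hS P hP, by
      have := eval_map_finTwo (Int.castRingHom ℚ) P.1 P.2 H
      rw [(hHS P hP).1, map_zero] at this
      exact this⟩
    rw [totalDegree_map_of_injective H hinj, hd] at this
    exact this.trans ((Nat.mul_le_mul_left _ hHd).trans (Nat.le_add_right _ _))

theorem exists_primes_between {P Q r : ℕ} (h : P + r ≤ Nat.primeCounting Q) :
    ∃ T : Finset ℕ, T.card = r ∧ ∀ p ∈ T, p.Prime ∧ P ≤ p ∧ p ≤ Q := by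
  have hsub : Nat.primesLE Q ⊆ Finset.range P ∪ (Finset.Icc P Q).filter Nat.Prime := by
    intro p hp
    rw [Nat.mem_primesLE] at hp
    simp only [Finset.mem_union, Finset.mem_range, Finset.mem_filter, Finset.mem_Icc]
    by_cases hpP : p < P
    · exact Or.inl hpP
    · exact Or.inr ⟨⟨not_lt.1 hpP, hp.1⟩, hp.2⟩
  have hcard := (Finset.card_le_card hsub).trans (Finset.card_union_le _ _)
  rw [Nat.primesLE_card_eq_primeCounting, Finset.card_range] at hcard
  obtain ⟨T, hT, hTr⟩ := Finset.exists_subset_card_eq (s := (Finset.Icc P Q).filter Nat.Prime)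
    (n := r) (by omega)
  refine ⟨T, hTr, fun p hp => ?_⟩
  obtain ⟨h1, h2⟩ := Finset.mem_filter.1 (hT hp)
  exact ⟨h2, Finset.mem_Icc.1 h1⟩

theorem add_le_primeCounting_mul_cube {P D : ℕ} (hP : 1 ≤ P) (hD : 64 ≤ D)
    (hlog : Real.log P ≤ D / 2 + 11) :
    P + 4 * D ≤ Nat.primeCounting (P * D ^ 3) := by
  have hP' : (1 : ℝ) ≤ P := by exact_mod_cast hP
  have hD' : (64 : ℝ) ≤ D := by exact_mod_cast hD
  have hpi := Chebyshev.pi_ge (P * D ^ 3)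
  push_cast at hpi
  have hQ : (262144 : ℝ) ≤ P * D ^ 3 := by
    have : (64 : ℝ) ^ 3 ≤ (D : ℝ) ^ 3 := by gcongr
    nlinarith
  have hlogQ : Real.log (P * D ^ 3) ≤ 4 * D := by
    rw [Real.log_mul (by positivity) (by positivity), Real.log_pow]
    have := Real.log_le_sub_one_of_pos (show (0 : ℝ) < D by positivity)
    push_cast
    linarith
  have hlogQ1 : Real.log (P * D ^ 3 + 1) ≤ 5 * D := by
    have h1 : Real.log (P * D ^ 3 + 1) ≤ Real.log (P * D ^ 3 * 2) :=
      Real.log_le_log (by positivity) (by linarith)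
    rw [Real.log_mul (by positivity) (by norm_num)] at h1
    linarith [Real.log_two_lt_d9]
  have hQpos : 0 < Real.log (P * D ^ 3) := Real.log_pos (by linarith)
  have hmain : ((P : ℝ) + 4 * D) ≤ Nat.primeCounting (P * D ^ 3) := by
    refine le_trans ?_ hpi
    rw [le_div_iff₀ hQpos]
    have h1 : ((P : ℝ) + 4 * D) * Real.log (P * D ^ 3) ≤ (P + 4 * D) * (4 * D) := by gcongr
    have h2 : (0.69 : ℝ) * (P * D ^ 3) ≤ P * D ^ 3 * Real.log 2 := by
      nlinarith [Real.log_two_gt_d9]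
    have h3 : (64 : ℝ) * (P * D ^ 2) ≤ P * D ^ 3 := by
      have : (0 : ℝ) ≤ P * D ^ 2 := by positivity
      nlinarith
    have h4 : (D : ℝ) ^ 2 ≤ P * D ^ 2 := by
      have : (0 : ℝ) ≤ D ^ 2 := by positivity
      nlinarith
    have h5 : (P : ℝ) * D ≤ P * D ^ 2 := by
      have : (0 : ℝ) ≤ P * D := by positivity
      nlinarith
    nlinarith
  exact_mod_cast hmain

theorem factorial_mul_pow_lt_pow {d D N P : ℕ} (hd : 2 ≤ d) (hD : 64 ≤ D) (hN : 1 ≤ N)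
    (hND : Real.log N ≤ D) (hP : Real.exp (Real.log N / d + 10) ≤ P) :
    (D * d).factorial * N ^ (d * (d * D + ∑ i ∈ Finset.range D, i))
      < P ^ (∑ i ∈ Finset.range (D * d), i) := by
  have hd' : (2 : ℝ) ≤ d := by exact_mod_cast hd
  have hD' : (64 : ℝ) ≤ D := by exact_mod_cast hD
  have hN' : (1 : ℝ) ≤ N := by exact_mod_cast hN
  have hgauss : ∀ n : ℕ, ((∑ i ∈ Finset.range n, i : ℕ) : ℝ) = n * (n - 1) / 2 := by
    intro n
    induction n with
    | zero => simp
    | succ n ih =>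
      rw [Finset.sum_range_succ, Nat.cast_add, ih]
      push_cast
      ring
  have hL : 0 ≤ Real.log N := Real.log_nonneg hN'
  set L := Real.log N with hLdef
  have hfact : ((D * d).factorial : ℝ) ≤ Real.exp ((D * d) * (D * d)) := by
    have h1 : ((D * d).factorial : ℝ) ≤ ((D * d : ℕ) : ℝ) ^ (D * d) := by
      exact_mod_cast Nat.factorial_le_pow _
    refine h1.trans ?_
    rw [show ((D : ℝ) * d) * (D * d) = ((D * d : ℕ) : ℝ) * (D * d) by push_cast; ring,
      Real.exp_nat_mul]
    gcongr
    push_cast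
    linarith [Real.add_one_le_exp ((D : ℝ) * d)]
  have hNexp : (N : ℝ) = Real.exp L := (Real.exp_log (by positivity)).symm
  have hfinal : ((D * d).factorial : ℝ) * (N : ℝ) ^ (d * (d * D + ∑ i ∈ Finset.range D, i))
      < (P : ℝ) ^ (∑ i ∈ Finset.range (D * d), i) := by
    calc _ ≤ Real.exp ((D * d) * (D * d)) *
          Real.exp L ^ (d * (d * D + ∑ i ∈ Finset.range D, i)) := by rw [← hNexp]; gcongr
      _ = Real.exp ((D * d) * (D * d) +
            (d * (d * D + ∑ i ∈ Finset.range D, i) : ℕ) * L) := by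
        rw [← Real.exp_nat_mul, ← Real.exp_add]
      _ < Real.exp ((∑ i ∈ Finset.range (D * d), i : ℕ) * (L / d + 10)) := by
        rw [Real.exp_lt_exp, hgauss, Nat.cast_mul, Nat.cast_add, hgauss]
        push_cast
        have hx : L / d * d = L := by field_simp
        have h1 : (D * d * (D * d - 1) / 2 : ℝ) * (L / d + 10)
            = D * (D * d - 1) / 2 * L + 5 * (D * d * (D * d - 1)) := by
          field_simp
          ring
        rw [h1]
        have h2 : (D : ℝ) * (d * d) * L ≤ D * (d * d) * D := by gcongr
        have h3 : (D : ℝ) * L ≤ D * D := by gcongr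
        have h4 : (64 : ℝ) * (D * d) ≤ D * d * D := by
          have : (0 : ℝ) ≤ D * d := by positivity
          nlinarith
        have h5 : 2 * ((D : ℝ) * D * d) ≤ D * D * d * d := by
          have : (0 : ℝ) ≤ D * D * d := by positivity
          nlinarith
        have h6 : 2 * ((D : ℝ) * D) ≤ D * D * d := by
          have : (0 : ℝ) ≤ D * D := by positivity
          nlinarith
        have h7 : 0 ≤ (D : ℝ) * d * L := by positivity
        nlinarith
      _ = Real.exp (L / d + 10) ^ (∑ i ∈ Finset.range (D * d), i) := Real.exp_nat_mul _ _
      _ ≤ _ := by gcongr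
  exact_mod_cast hfinal

theorem small_equation_bound_lt_pow {d N P : ℕ} (hd : 2 ≤ d) (hdN : (d + 1) ^ 2 ≤ N)
    (hP : N < P ^ d) :
    (d + 1) ^ 2 * (d * N ^ d * ((d + 1) ^ 2 * N ^ d) ^ ((d + 1) ^ 2)) < P ^ (4 * d ^ 4) := by
  have hN : 0 < N := lt_of_lt_of_le (by positivity) hdN
  have hdN' : d ≤ N := by nlinarith
  calc (d + 1) ^ 2 * (d * N ^ d * ((d + 1) ^ 2 * N ^ d) ^ ((d + 1) ^ 2))
      ≤ N * (N * N ^ d * (N * N ^ d) ^ ((d + 1) ^ 2)) := by gcongr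
    _ = N ^ (2 + d + (d + 1) ^ 3) := by ring
    _ ≤ N ^ (4 * d ^ 3) := by
      refine Nat.pow_le_pow_right hN ?_
      obtain ⟨k, rfl⟩ := Nat.exists_eq_add_of_le hd
      ring_nf
      nlinarith [sq_nonneg k]
    _ < (P ^ d) ^ (4 * d ^ 3) := Nat.pow_lt_pow_left hP (by positivity)
    _ = P ^ (4 * d ^ 4) := by rw [← pow_mul]; congr 1; ring

open MvPolynomial in
theorem card_zeros_le_of_totalDegree_eq_one {G : MvPolynomial (Fin 2) ℤ}
    (hG : Irreducible (map (Int.castRingHom ℚ) G)) (hd : G.totalDegree = 1) {N : ℕ}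
    (S : Finset (ℤ × ℤ)) (hbox : ∀ P ∈ S, 0 ≤ P.1 ∧ P.1 ≤ N ∧ 0 ≤ P.2 ∧ P.2 ≤ N)
    (hS : ∀ P ∈ S, eval ![P.1, P.2] G = 0) : S.card ≤ N + 1 := by
  classical
  have hIcc : (Finset.Icc (0 : ℤ) N).card = N + 1 := by simp
  rw [← hIcc]
  by_cases hline : ∃ x : ℤ, map (Int.castRingHom ℚ) G ∣ X 0 - C (x : ℚ)
  · obtain ⟨x, F, hF⟩ := hline
    have hx : ∀ P ∈ S, P.1 = x := by
      intro P hP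
      have h := eval_map_finTwo (Int.castRingHom ℚ) P.1 P.2 G
      have h' := congrArg (eval ![Int.castRingHom ℚ P.1, Int.castRingHom ℚ P.2]) hF
      rw [map_mul, h, hS P hP, map_zero, zero_mul] at h'
      simp only [eq_intCast, map_sub, eval_X, eval_C, Matrix.cons_val_zero, sub_eq_zero] at h'
      exact_mod_cast h'
    refine Finset.card_le_card_of_injOn Prod.snd (fun P hP => ?_) fun P hP Q hQ h => ?_
    · obtain ⟨-, -, h0, h1⟩ := hbox P hP
      exact Finset.mem_coe.2 (Finset.mem_Icc.2 ⟨h0, h1⟩)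
    · exact Prod.ext ((hx P hP).trans (hx Q hQ).symm) h
  · push Not at hline
    refine (Finset.card_le_mul_card_image_of_maps_to (f := Prod.fst) (fun P hP => ?_) 1
      fun x _ => ?_).trans_eq (one_mul _)
    · obtain ⟨h0, h1, -, -⟩ := hbox P hP
      exact Finset.mem_Icc.2 ⟨h0, h1⟩
    · have hdeg : (X 0 - C (x : ℚ) : MvPolynomial (Fin 2) ℚ).totalDegree ≤ 1 := by
        refine (totalDegree_sub _ _).trans ?_
        rw [totalDegree_X, totalDegree_C]
        simp
      have := card_integral_common_zeros_le hG (hline x) (S.filter fun P => P.1 = x) fun P hP => by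
        obtain ⟨hPS, hPx⟩ := Finset.mem_filter.1 hP
        exact ⟨hS P hPS, by simp [hPx]⟩
      rw [hd, one_mul] at this
      exact this.trans hdeg

/-- The bound for the number of integral points in terms of `D ≥ log N`, for curves of degree at
least `2`. -/
theorem card_zeros_le_of_log_le {G : MvPolynomial (Fin 2) ℤ}
    (hG : Irreducible (MvPolynomial.map (Int.castRingHom ℚ) G)) {d : ℕ} (hd : G.totalDegree = d)
    (hd2 : 2 ≤ d) {N D : ℕ} (hN : Real.exp ((d : ℝ) ^ 6) ≤ N) (hD : Real.log N ≤ D)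
    (S : Finset (ℤ × ℤ)) (hbox : ∀ P ∈ S, 0 ≤ P.1 ∧ P.1 ≤ N ∧ 0 ≤ P.2 ∧ P.2 ≤ N)
    (hS : ∀ P ∈ S, MvPolynomial.eval ![P.1, P.2] G = 0) :
    (S.card : ℝ) ≤ 9 * (D : ℝ) ^ 7 * Real.exp (Real.log N / d + 11) := by
  have hd' : (2 : ℝ) ≤ d := by exact_mod_cast hd2
  have hNpos : (0 : ℝ) < N := (Real.exp_pos _).trans_le hN
  have hL : (d : ℝ) ^ 6 ≤ Real.log N := (Real.le_log_iff_exp_le hNpos).2 hN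
  have hdD : d ^ 6 ≤ D := by exact_mod_cast hL.trans hD
  have hd64 : 2 ^ 6 ≤ d ^ 6 := Nat.pow_le_pow_left hd2 6
  have hD64 : 64 ≤ D := by omega
  have hdD1 : d ≤ D := (Nat.le_self_pow (by norm_num) d).trans hdD
  have hdD4 : d ^ 4 ≤ D := (Nat.pow_le_pow_right (by omega) (by norm_num)).trans hdD
  have hD' : (64 : ℝ) ≤ D := by exact_mod_cast hD64
  have hN1 : 1 ≤ N := by exact_mod_cast hNpos
  have hL0 : 0 ≤ Real.log N := le_trans (by positivity) hL
  have hdN : (d + 1) ^ 2 ≤ N := by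
    have h1 := (Real.add_one_le_exp ((d : ℝ) ^ 6)).trans hN
    have h2 : d ^ 6 + 1 ≤ N := by exact_mod_cast h1
    have h3 : d ^ 3 ≤ d ^ 6 := Nat.pow_le_pow_right (by omega) (by norm_num)
    have h4 : 2 * d ^ 2 ≤ d ^ 3 := by rw [pow_succ d 2, mul_comm]; gcongr
    nlinarith
  obtain ⟨P, hPdef⟩ : ∃ P, P = ⌈Real.exp (Real.log N / d + 10)⌉₊ := ⟨_, rfl⟩
  have hP : Real.exp (Real.log N / d + 10) ≤ P := hPdef ▸ Nat.le_ceil _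
  have hPpos : (0 : ℝ) < P := (Real.exp_pos _).trans_le hP
  have hP1 : 1 ≤ P := by exact_mod_cast hPpos
  have hPup : (P : ℝ) ≤ Real.exp (Real.log N / d + 11) := by
    have h1 : (P : ℝ) < Real.exp (Real.log N / d + 10) + 1 :=
      hPdef ▸ Nat.ceil_lt_add_one (Real.exp_pos _).le
    have h2 : (1 : ℝ) ≤ Real.exp (Real.log N / d + 10) := Real.one_le_exp (by positivity)
    have h3 : Real.exp (Real.log N / d + 11) = Real.exp (Real.log N / d + 10) * Real.exp 1 := by
      rw [← Real.exp_add]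
      congr 1
      ring
    have h4 := Real.add_one_le_exp (1 : ℝ)
    nlinarith
  have hPlog : Real.log P ≤ D / 2 + 11 := by
    refine ((Real.log_le_iff_le_exp hPpos).2 hPup).trans ?_
    gcongr
  have hNP : N < P ^ d := by
    have h1 : (N : ℝ) < (P : ℝ) ^ d := by
      calc (N : ℝ) = Real.exp (Real.log N) := (Real.exp_log hNpos).symm
        _ < Real.exp (d * (Real.log N / d + 10)) := by
          rw [Real.exp_lt_exp, mul_add, mul_div_cancel₀ _ (by positivity)]
          linarith
        _ = Real.exp (Real.log N / d + 10) ^ d := Real.exp_nat_mul _ _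
        _ ≤ _ := by gcongr
    exact_mod_cast h1
  obtain ⟨T, hTcard, hT⟩ := exists_primes_between (P := P) (Q := P * D ^ 3) (r := 4 * d ^ 4)
    (le_trans (by omega) (add_le_primeCounting_mul_cube hP1 hD64 hPlog))
  have hcount := card_zeros_le hG hd hd2 hN1 (factorial_mul_pow_lt_pow hd2 hD64 hN1 hD hP) T hT
    (hTcard ▸ small_equation_bound_lt_pow hd2 hdN hNP) S hbox hS
  rw [hTcard] at hcount
  have hcount' : S.card ≤ 9 * D ^ 7 * P := by
    calc S.card ≤ d * d + 4 * d ^ 4 * (d * (d + D) * (d * (P * D ^ 3))) := hcount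
      _ ≤ D * D + 4 * D * (D * (D + D) * (D * (P * D ^ 3))) := by gcongr
      _ = D ^ 2 * 1 + 8 * D ^ 7 * P := by ring
      _ ≤ D ^ 7 * P + 8 * D ^ 7 * P := by
        gcongr
        · omega
        · norm_num
      _ = 9 * D ^ 7 * P := by ring
  calc (S.card : ℝ) ≤ 9 * (D : ℝ) ^ 7 * P := by exact_mod_cast hcount'
    _ ≤ _ := by gcongr

theorem add_one_le_mul_exp_sqrt {N : ℕ} (hN : 3 ≤ N) :
    (N : ℝ) + 1 ≤ N * Real.exp (12 * Real.sqrt (Real.log N * Real.log (Real.log N))) := by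
  have hN' : (3 : ℝ) ≤ N := by exact_mod_cast hN
  have hL : 1.01 ≤ Real.log N := by
    rw [Real.le_log_iff_exp_le (by linarith)]
    have h1 : Real.exp 1.01 * Real.exp (-0.01) = Real.exp 1 := by
      rw [← Real.exp_add]
      norm_num
    nlinarith [Real.exp_one_lt_d9, Real.add_one_le_exp (-0.01 : ℝ), Real.exp_pos 1.01]
  have hLL : 0.1 ^ 2 ≤ Real.log N * Real.log (Real.log N) := by
    have h1 := Real.one_sub_inv_le_log_of_pos (show 0 < Real.log N by linarith)
    have h2 : Real.log N * (Real.log N)⁻¹ = 1 := mul_inv_cancel₀ (by linarith)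
    nlinarith
  have hsqrt := Real.le_sqrt_of_sq_le hLL
  have h1 := Real.add_one_le_exp (12 * Real.sqrt (Real.log N * Real.log (Real.log N)))
  nlinarith

theorem ceil_pow_mul_exp_le {L d : ℝ} (hL : 64 ≤ L) (hd : 2 ≤ d) :
    9 * (⌈L⌉₊ : ℝ) ^ 7 * Real.exp 11 ≤ Real.exp (12 * Real.sqrt (d * L * Real.log L)) := by
  have hD : (⌈L⌉₊ : ℝ) ≤ 2 * L := by linarith [Nat.ceil_lt_add_one (show 0 ≤ L by linarith)]
  have he : Real.exp 11 ≤ 3 ^ 11 := by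
    have h1 : Real.exp 11 = Real.exp 1 ^ 11 := by rw [← Real.exp_nat_mul]; norm_num
    rw [h1]
    gcongr
    linarith [Real.exp_one_lt_d9]
  have hlog : 0 ≤ Real.log L := Real.log_nonneg (by linarith)
  have hlogL : Real.log L ≤ L := Real.log_le_self (by linarith)
  have hsqrt : Real.log L ≤ Real.sqrt (d * L * Real.log L) := by
    refine Real.le_sqrt_of_sq_le ?_
    rw [sq]
    gcongr
    nlinarith
  calc 9 * (⌈L⌉₊ : ℝ) ^ 7 * Real.exp 11 ≤ 9 * (2 * L) ^ 7 * 3 ^ 11 := by gcongr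
    _ = (9 * 2 ^ 7 * 3 ^ 11) * L ^ 7 := by ring
    _ ≤ L ^ 5 * L ^ 7 := by
      gcongr
      exact le_trans (by norm_num) (pow_le_pow_left₀ (by norm_num) hL 5)
    _ = Real.exp (Real.log L) ^ 12 := by rw [Real.exp_log (by linarith)]; ring
    _ = Real.exp (12 * Real.log L) := by rw [← Real.exp_nat_mul]; norm_num
    _ ≤ _ := by gcongr

/-- Bombieri–Pila: if `G(x,y) ∈ ℤ[x,y]` is absolutely irreducible of total degree `d` and
`N ≥ exp(d⁶)` is an integer, then the number of integer points `(x,y) ∈ [0,N]²` with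
`G(x,y) = 0` is at most `N^(1/d) · exp(12 √(d · log N · log log N))`. -/
theorem bombieri_pila (G : MvPolynomial (Fin 2) ℤ) (d : ℕ) (hd : G.totalDegree = d)
    (hirr : Irreducible (MvPolynomial.map (Int.castRingHom Qbar) G))
    (N : ℕ) (hN : Real.exp ((d : ℝ) ^ 6) ≤ (N : ℝ)) :
    (Nat.card {p : ℤ × ℤ // 0 ≤ p.1 ∧ p.1 ≤ (N : ℤ) ∧ 0 ≤ p.2 ∧ p.2 ≤ (N : ℤ) ∧
        MvPolynomial.eval ![p.1, p.2] G = 0} : ℝ)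
      ≤ (N : ℝ) ^ ((1 : ℝ) / (d : ℝ)) *
        Real.exp (12 * Real.sqrt ((d : ℝ) * Real.log N * Real.log (Real.log N))) := by
  have hirrQ : Irreducible (MvPolynomial.map (Int.castRingHom ℚ) G) := by
    refine irreducible_of_map (algebraMap ℚ Qbar) ?_
    rwa [MvPolynomial.map_map, show (algebraMap ℚ Qbar).comp (Int.castRingHom ℚ) =
      Int.castRingHom Qbar from RingHom.ext_int _ _]
  let S : Finset (ℤ × ℤ) := (Finset.Icc 0 (N : ℤ) ×ˢ Finset.Icc 0 (N : ℤ)).filter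
    fun p => MvPolynomial.eval ![p.1, p.2] G = 0
  have hmem : ∀ p : ℤ × ℤ, p ∈ S ↔ 0 ≤ p.1 ∧ p.1 ≤ (N : ℤ) ∧ 0 ≤ p.2 ∧ p.2 ≤ (N : ℤ) ∧
      MvPolynomial.eval ![p.1, p.2] G = 0 := by
    intro p
    simp only [S, Finset.mem_filter, Finset.mem_product, Finset.mem_Icc]
    tauto
  rw [Nat.subtype_card S hmem]
  have hbox : ∀ P ∈ S, 0 ≤ P.1 ∧ P.1 ≤ (N : ℤ) ∧ 0 ≤ P.2 ∧ P.2 ≤ (N : ℤ) := by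
    intro P hP
    have := (hmem P).1 hP
    tauto
  have hS : ∀ P ∈ S, MvPolynomial.eval ![P.1, P.2] G = 0 := fun P hP =>
    ((hmem P).1 hP).2.2.2.2
  have hNpos : (0 : ℝ) < N := (Real.exp_pos _).trans_le hN
  have hL : (d : ℝ) ^ 6 ≤ Real.log N := (Real.le_log_iff_exp_le hNpos).2 hN
  have hd0 : d ≠ 0 := by
    rintro rfl
    rw [MvPolynomial.totalDegree_eq_zero_iff_eq_C] at hd
    rw [hd, MvPolynomial.map_C] at hirrQ
    refine hirrQ.not_isUnit (IsUnit.map MvPolynomial.C (isUnit_iff_ne_zero.2 fun h => ?_))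
    exact hirrQ.ne_zero (by rw [h, map_zero])
  rcases (show d = 1 ∨ 2 ≤ d by omega) with rfl | hd2
  · have hN3 : 3 ≤ N := by
      have h1 : (2 : ℝ) < N := by
        rw [Nat.cast_one, one_pow] at hN
        linarith [Real.exp_one_gt_d9]
      exact_mod_cast h1
    simpa using (Nat.cast_le (α := ℝ)).2 (card_zeros_le_of_totalDegree_eq_one hirrQ hd S hbox hS)
      |>.trans (by simpa using add_one_le_mul_exp_sqrt hN3)
  · have hL64 : (64 : ℝ) ≤ Real.log N := by
      have : (2 : ℝ) ^ 6 ≤ (d : ℝ) ^ 6 := by gcongr; exact_mod_cast hd2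
      linarith
    refine (card_zeros_le_of_log_le hirrQ hd hd2 hN (Nat.le_ceil _) S hbox hS).trans ?_
    have hpow : (N : ℝ) ^ ((1 : ℝ) / (d : ℝ)) = Real.exp (Real.log N / d) := by
      rw [Real.rpow_def_of_pos hNpos, mul_one_div]
    rw [hpow, Real.exp_add, mul_left_comm]
    gcongr
    exact ceil_pow_mul_exp_le hL64 (by exact_mod_cast hd2)
end
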